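/- arXiv:2004.04553 — 2 statements merged into one kernel-verified Lean document; each statement's English description precedes it below -/
import Mathlib

section
/- Let d ≥ 1 and V > 0. Let f₁, f₂ : (0,∞) → ℝ belong to the class F, i.e. f_i(r) = ∫₀^∞ e^{−rt} dμ_i(t) for some signed Borel measure μ_i on (0,∞) and f_i(r) = O(r^{−s_i}) as r → ∞ for some s_i > d/2 (i = 1,2). Then the scaled cubic lattice V^{1/d}ℤ^d with alternating charges is a critical point of the alternating-charge energy among lattices of covolume V: for every real d×d matrix H with trace(H) = 0, the function t ↦ Σ_{n∈ℤ^d∖{0}} [ f₁(V^{2/d}·|(I + tH)n|²) + (−1)^{n₁+⋯+n_d} f₂(V^{2/d}·|(I + tH)n|²) ] is differentiable at t = 0 and its derivative at t = 0 equals 0. -/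
open Filter MeasureTheory Set

noncomputable section

/-- Membership in the class `F`: `f` is the Laplace transform of a signed Borel
measure on `(0,∞)` (written as a difference of two nonnegative measures) and
`f(r) = O(r^{-s})` as `r → ∞` for some `s > d/2`. -/
def InClassF (d : ℕ) (f : ℝ → ℝ) : Prop :=
  (∃ μp μm : Measure ℝ,
    ∀ r : ℝ, 0 < r →
      Integrable (fun t => Real.exp (-(r * t))) (μp.restrict (Ioi 0)) ∧
      Integrable (fun t => Real.exp (-(r * t))) (μm.restrict (Ioi 0)) ∧
      f r = (∫ t in Ioi 0, Real.exp (-(r * t)) ∂μp)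
            - ∫ t in Ioi 0, Real.exp (-(r * t)) ∂μm) ∧
  ∃ s : ℝ, s > d / 2 ∧ f =O[atTop] fun r : ℝ => r ^ (-s)

/-- `g` is bounded by a multiple of `r ^ (-a)` on `[r₀, ∞)`. -/
def PowBound (r₀ : ℝ) (g : ℝ → ℝ) (a : ℝ) : Prop :=
  ∃ C : ℝ, 0 ≤ C ∧ ∀ r : ℝ, r₀ ≤ r → |g r| ≤ C * r ^ (-a)

/-- Landau-type interpolation: power bounds for a function and its second derivative give a power
bound for the first derivative, with the averaged exponent. -/
theorem PowBound.interpolate {r₀ : ℝ} (hr₀ : 0 < r₀) {g₀ g₁ g₂ : ℝ → ℝ}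
    (h₀ : ∀ r, 0 < r → HasDerivAt g₀ (g₁ r) r) (h₁ : ∀ r, 0 < r → HasDerivAt g₁ (g₂ r) r)
    {α β : ℝ} (hα : 0 ≤ α) (hβ : 0 ≤ β) (hg₀ : PowBound r₀ g₀ α) (hg₂ : PowBound r₀ g₂ β) :
    PowBound r₀ g₁ ((α + β) / 2) := by
  obtain ⟨C, hC, hg₀⟩ := hg₀
  obtain ⟨D, hD, hg₂⟩ := hg₂
  refine ⟨2 * C + D, by positivity, fun r hr => ?_⟩
  have hr0 : 0 < r := hr₀.trans_le hr
  set h : ℝ := r ^ ((β - α) / 2) with hh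
  have hpos : 0 < h := Real.rpow_pos_of_pos hr0 _
  have hlt : r < r + h := by linarith
  have mono : ∀ γ : ℝ, 0 ≤ γ → ∀ u, r ≤ u → u ^ (-γ) ≤ r ^ (-γ) := fun γ hγ u hu =>
    Real.rpow_le_rpow_of_nonpos hr0 hu (by linarith)
  obtain ⟨ξ, hξ, hξe⟩ := exists_hasDerivAt_eq_slope g₀ g₁ hlt
    (fun x hx => (h₀ x (hr0.trans_le hx.1)).continuousAt.continuousWithinAt)
    (fun x hx => h₀ x (hr0.trans hx.1))
  obtain ⟨η, hη, hηe⟩ := exists_hasDerivAt_eq_slope g₁ g₂ hξ.1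
    (fun x hx => (h₁ x (hr0.trans_le hx.1)).continuousAt.continuousWithinAt)
    (fun x hx => h₁ x (hr0.trans hx.1))
  have e1 : h * g₁ ξ = g₀ (r + h) - g₀ r := by
    rw [hξe, add_sub_cancel_left]; field_simp
  have e2 : g₁ r = g₁ ξ - g₂ η * (ξ - r) := by
    have : ξ - r ≠ 0 := by linarith [hξ.1]
    rw [hηe]; field_simp; ring
  have b1 : h * |g₁ ξ| ≤ 2 * C * r ^ (-α) := by
    have e : h * |g₁ ξ| = |g₀ (r + h) - g₀ r| := by
      rw [← e1, abs_mul, abs_of_pos hpos]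
    rw [e]
    have k1 := (hg₀ (r + h) (by linarith)).trans
      (mul_le_mul_of_nonneg_left (mono α hα (r + h) hlt.le) hC)
    have k2 := hg₀ r hr
    have := abs_sub (g₀ (r + h)) (g₀ r)
    linarith
  have b2 : |g₂ η| * (ξ - r) ≤ D * r ^ (-β) * h := by
    have k1 := (hg₂ η (by linarith [hη.1])).trans
      (mul_le_mul_of_nonneg_left (mono β hβ η hη.1.le) hD)
    exact mul_le_mul k1 (by linarith [hξ.2]) (by linarith [hξ.1]) (by positivity)
  have p1 : r ^ (-α) = h * r ^ (-((α + β) / 2)) := by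
    rw [hh, ← Real.rpow_add hr0]; congr 1; ring
  have p2 : r ^ (-β) * h = r ^ (-((α + β) / 2)) := by
    rw [hh, ← Real.rpow_add hr0]; congr 1; ring
  have b1' : |g₁ ξ| ≤ 2 * C * r ^ (-((α + β) / 2)) := by
    rw [p1] at b1
    refine le_of_mul_le_mul_left (b1.trans (le_of_eq ?_)) hpos
    ring
  calc |g₁ r| ≤ |g₁ ξ| + |g₂ η * (ξ - r)| := by rw [e2]; exact abs_sub _ _
    _ = |g₁ ξ| + |g₂ η| * (ξ - r) := by rw [abs_mul, abs_of_pos (sub_pos.2 hξ.1)]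
    _ ≤ 2 * C * r ^ (-((α + β) / 2)) + D * r ^ (-((α + β) / 2)) := by
        rw [mul_assoc D, p2] at b2; gcongr
    _ = _ := by ring

/-- If all derivatives `g k` of `g 0` have the scaling bound `r ^ (-(k + p))`, then extra decay
`r ^ (-a)` of `g 0` passes to `g 1` with arbitrarily small relative loss in `a`. -/
theorem exists_powBound_deriv {r₀ : ℝ} (hr₀ : 0 < r₀) (m : ℕ) :
    ∃ θ : ℝ, 0 ≤ θ ∧ 1 - θ ≤ 2 / (m + 2) ∧ ∀ (g : ℕ → ℝ → ℝ) (p a : ℝ), 0 ≤ p → 0 ≤ a →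
      (∀ k r, 0 < r → HasDerivAt (g k) (g (k + 1) r) r) →
      (∀ k : ℕ, PowBound r₀ (g k) (p + k)) → PowBound r₀ (g 0) (p + a) →
      PowBound r₀ (g 1) (p + 1 + θ * a) := by
  induction m with
  | zero =>
    refine ⟨0, le_rfl, by norm_num, fun g p a _ _ _ hk _ => ?_⟩
    simpa using hk 1
  | succ m ih =>
    obtain ⟨θ, hθ, hm, ih⟩ := ih
    refine ⟨(1 + θ ^ 2) / 2, by positivity, ?_, fun g p a hp ha hg hk h0 => ?_⟩
    · have hx : (0 : ℝ) < m + 2 := by positivity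
      have h1 : 1 - (1 + θ ^ 2) / 2 ≤ 2 / ((m : ℝ) + 2) - (2 / (m + 2)) ^ 2 / 2 := by
        have : 2 / ((m : ℝ) + 2) ≤ 1 := by
          rw [div_le_one hx]; linarith [(Nat.cast_nonneg m : (0 : ℝ) ≤ m)]
        nlinarith
      refine h1.trans ?_
      push_cast
      have e : 2 / ((m : ℝ) + 2) - (2 / (m + 2)) ^ 2 / 2 = 2 * (m + 1) / (m + 2) ^ 2 := by
        field_simp; ring
      rw [e, div_le_div_iff₀ (by positivity) (by positivity)]
      nlinarith
    · have h1 := ih g p a hp ha hg hk h0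
      have h2 := ih (fun k => g (k + 1)) (p + 1) (θ * a) (by positivity) (by positivity)
        (fun k => hg (k + 1)) (fun k => by
          have := hk (k + 1)
          push_cast at this
          convert this using 1; ring) h1
      have h3 := PowBound.interpolate hr₀ (hg 0) (hg 1) (by positivity) (by positivity) h0 h2
      convert h3 using 1; ring

theorem PowBound.sub {r₀ a : ℝ} {g h : ℝ → ℝ} (hg : PowBound r₀ g a) (hh : PowBound r₀ h a) :
    PowBound r₀ (fun r => g r - h r) a := by
  obtain ⟨C, hC, hg⟩ := hg
  obtain ⟨D, hD, hh⟩ := hh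
  refine ⟨C + D, by positivity, fun r hr => (abs_sub _ _).trans ?_⟩
  rw [add_mul]
  exact add_le_add (hg r hr) (hh r hr)

/-- The `k`-th derivative of the Laplace transform of `μ` restricted to `(0,∞)`. -/
def laplaceDeriv (μ : Measure ℝ) (k : ℕ) (r : ℝ) : ℝ :=
  ∫ t in Ioi 0, (-t) ^ k * Real.exp (r * -t) ∂μ

theorem mem_interior_integrableExpSet_neg {μ : Measure ℝ}
    (hμ : ∀ r : ℝ, 0 < r → Integrable (fun t => Real.exp (-(r * t))) (μ.restrict (Ioi 0)))
    {r : ℝ} (hr : 0 < r) :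
    r ∈ interior (ProbabilityTheory.integrableExpSet (fun t : ℝ => -t) (μ.restrict (Ioi 0))) := by
  refine mem_interior.2 ⟨Ioi 0, fun x hx => ?_, isOpen_Ioi, hr⟩
  simpa [ProbabilityTheory.integrableExpSet] using hμ x hx

theorem hasDerivAt_laplaceDeriv {μ : Measure ℝ}
    (hμ : ∀ r : ℝ, 0 < r → Integrable (fun t => Real.exp (-(r * t))) (μ.restrict (Ioi 0)))
    (k : ℕ) {r : ℝ} (hr : 0 < r) :
    HasDerivAt (laplaceDeriv μ k) (laplaceDeriv μ (k + 1) r) r :=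
  ProbabilityTheory.hasDerivAt_integral_pow_mul_exp_real
    (mem_interior_integrableExpSet_neg hμ hr) k

theorem powBound_laplaceDeriv {μ : Measure ℝ}
    (hμ : ∀ r : ℝ, 0 < r → Integrable (fun t => Real.exp (-(r * t))) (μ.restrict (Ioi 0)))
    {r₀ : ℝ} (hr₀ : 0 < r₀) (k : ℕ) :
    PowBound r₀ (laplaceDeriv μ k) k := by
  set I := ∫ t in Ioi 0, Real.exp (-(r₀ / 2 * t)) ∂μ with hI
  have hI0 : 0 ≤ I := integral_nonneg fun t => (Real.exp_pos _).le
  refine ⟨2 ^ k * k.factorial * I, by positivity, fun r hr => ?_⟩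
  have hr0 : 0 < r := hr₀.trans_le hr
  rw [Real.rpow_neg hr0.le, Real.rpow_natCast]
  have key : ∀ t ∈ Ioi (0 : ℝ), ‖(-t) ^ k * Real.exp (r * -t)‖ ≤
      2 ^ k * k.factorial * (r ^ k)⁻¹ * Real.exp (-(r₀ / 2 * t)) := by
    intro t (ht : 0 < t)
    rw [norm_mul, norm_pow, norm_neg, Real.norm_of_nonneg ht.le,
      Real.norm_of_nonneg (Real.exp_pos _).le]
    have h1 := Real.pow_div_factorial_le_exp (r * t / 2) (by positivity) k
    have h2 : t ^ k ≤ 2 ^ k * k.factorial * (r ^ k)⁻¹ * Real.exp (r * t / 2) := by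
      calc t ^ k = 2 ^ k * k.factorial * (r ^ k)⁻¹ * ((r * t / 2) ^ k / k.factorial) := by
            rw [div_pow, mul_pow]; field_simp
        _ ≤ _ := by gcongr
    calc t ^ k * Real.exp (r * -t)
        ≤ 2 ^ k * k.factorial * (r ^ k)⁻¹ * Real.exp (r * t / 2) * Real.exp (r * -t) := by gcongr
      _ = 2 ^ k * k.factorial * (r ^ k)⁻¹ * Real.exp (-(r / 2 * t)) := by
          rw [mul_assoc, ← Real.exp_add]; congr 2; ring
      _ ≤ _ := by gcongr
  calc |laplaceDeriv μ k r|
      ≤ ∫ t in Ioi 0, 2 ^ k * k.factorial * (r ^ k)⁻¹ * Real.exp (-(r₀ / 2 * t)) ∂μ :=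
        norm_integral_le_of_norm_le ((hμ (r₀ / 2) (by positivity)).const_mul _)
          (ae_restrict_of_forall_mem measurableSet_Ioi key)
    _ = _ := by rw [integral_const_mul, ← hI]; ring

/-- A function of class `F` is differentiable on `(0,∞)`, and both it and (after gaining one
power) its derivative decay faster than `r ^ (-d / 2)`. -/
theorem InClassF.exists_deriv {d : ℕ} {f : ℝ → ℝ} (hf : InClassF d f) :
    ∃ f' : ℝ → ℝ, (∀ r, 0 < r → HasDerivAt f (f' r) r) ∧ ∀ r₀ : ℝ, 0 < r₀ →
      ∃ s σ : ℝ, (d : ℝ) / 2 < s ∧ (d : ℝ) / 2 < σ ∧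
        PowBound r₀ f s ∧ PowBound r₀ f' (1 + σ) := by
  obtain ⟨⟨μ, ν, h⟩, s, hs, hO⟩ := hf
  have hμ := fun r hr => (h r hr).1
  have hν := fun r hr => (h r hr).2.1
  set g : ℕ → ℝ → ℝ := fun k r => laplaceDeriv μ k r - laplaceDeriv ν k r with hg
  have hfg : ∀ r, 0 < r → f r = g 0 r := fun r hr => by
    simp [hg, laplaceDeriv, (h r hr).2.2]
  have hgd : ∀ k r, 0 < r → HasDerivAt (g k) (g (k + 1) r) r := fun k r hr =>
    (hasDerivAt_laplaceDeriv hμ k hr).sub (hasDerivAt_laplaceDeriv hν k hr)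
  refine ⟨g 1, fun r hr => (hgd 0 r hr).congr_of_eventuallyEq ?_, fun r₀ hr₀ => ?_⟩
  · filter_upwards [Ioi_mem_nhds hr] with x hx using hfg x hx
  have hgk : ∀ k : ℕ, PowBound r₀ (g k) k := fun k =>
    (powBound_laplaceDeriv hμ hr₀ k).sub (powBound_laplaceDeriv hν hr₀ k)
  have hs0 : 0 < s := lt_of_le_of_lt (by positivity) hs
  have hfs : PowBound r₀ f s := by
    obtain ⟨C, hC, hfC⟩ := hO.exists_pos
    obtain ⟨R, hR⟩ := eventually_atTop.1 hfC.bound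
    obtain ⟨D, hD, hgD⟩ := hgk 0
    refine ⟨C + D * max R 1 ^ s, by positivity, fun r hr => ?_⟩
    have hr0 : 0 < r := hr₀.trans_le hr
    have hrs : 0 < r ^ (-s) := Real.rpow_pos_of_pos hr0 _
    rw [add_mul]
    rcases le_total (max R 1) r with hRr | hRr
    · have := hR r ((le_max_left _ _).trans hRr)
      rw [Real.norm_of_nonneg hrs.le, Real.norm_eq_abs] at this
      exact this.trans (le_add_of_nonneg_right (by positivity))
    · have h1 := hgD r hr
      rw [← hfg r hr0] at h1
      simp only [Nat.cast_zero, neg_zero, Real.rpow_zero, mul_one] at h1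
      have h2 : 1 ≤ max R 1 ^ s * r ^ (-s) := by
        calc (1 : ℝ) = r ^ s * r ^ (-s) := by rw [← Real.rpow_add hr0]; simp
          _ ≤ _ := by gcongr
      calc |f r| ≤ D * 1 := by linarith
        _ ≤ D * (max R 1 ^ s * r ^ (-s)) := by gcongr
        _ ≤ _ := by rw [mul_assoc]; exact le_add_of_nonneg_left (by positivity)
  have hgs : PowBound r₀ (g 0) s := by
    obtain ⟨C, hC, hb⟩ := hfs
    exact ⟨C, hC, fun r hr => by rw [← hfg r (hr₀.trans_le hr)]; exact hb r hr⟩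
  obtain ⟨m, hm⟩ := exists_nat_gt (2 * s / (s - d / 2))
  obtain ⟨θ, hθ, hmθ, key⟩ := exists_powBound_deriv hr₀ m
  have h1 := key g 0 s le_rfl hs0.le hgd (by simpa using hgk) (by simpa using hgs)
  refine ⟨s, θ * s, hs, ?_, hfs, by simpa using h1⟩
  have hpos : 0 < s - d / 2 := sub_pos.2 hs
  rw [div_lt_iff₀ hpos] at hm
  have h2 : (2 : ℝ) / (m + 2) * s < s - d / 2 := by
    rw [div_mul_eq_mul_div, div_lt_iff₀ (by positivity)]
    nlinarith
  nlinarith [mul_le_mul_of_nonneg_right hmθ hs0.le]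

theorem exists_abs_dotProduct_mulVec_le {d : ℕ} (A : Matrix (Fin d) (Fin d) ℝ) :
    ∃ K : ℝ, 0 ≤ K ∧ ∀ x : Fin d → ℝ, |x ⬝ᵥ A.mulVec x| ≤ K * ∑ i, x i ^ 2 := by
  refine ⟨∑ i, ∑ j, |A i j|, by positivity, fun x => ?_⟩
  have hx : ∀ i, x i ^ 2 ≤ ∑ i, x i ^ 2 := fun i =>
    Finset.single_le_sum (f := fun i => x i ^ 2) (fun i _ => sq_nonneg _) (Finset.mem_univ i)
  have e : x ⬝ᵥ A.mulVec x = ∑ i, ∑ j, A i j * (x i * x j) := by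
    simp only [dotProduct, Matrix.mulVec, Finset.mul_sum]
    exact Finset.sum_congr rfl fun i _ => Finset.sum_congr rfl fun j _ => by ring
  rw [e, Finset.sum_mul]
  refine (Finset.abs_sum_le_sum_abs _ _).trans (Finset.sum_le_sum fun i _ => ?_)
  rw [Finset.sum_mul]
  refine (Finset.abs_sum_le_sum_abs _ _).trans (Finset.sum_le_sum fun j _ => ?_)
  rw [abs_mul]
  refine mul_le_mul_of_nonneg_left (abs_le.2 ⟨?_, ?_⟩) (abs_nonneg _) <;>
    nlinarith [hx i, hx j, sq_nonneg (x i + x j), sq_nonneg (x i - x j)]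

/-- The Epstein zeta series of `ℤ ^ d` converges for exponents larger than `d / 2`. -/
theorem summable_sum_sq_rpow {d : ℕ} {s : ℝ} (hs : (d : ℝ) / 2 < s) :
    Summable fun n : Fin d → ℤ => (∑ i, (n i : ℝ) ^ 2) ^ (-s) := by
  set b := (EuclideanSpace.basisFun (Fin d) ℝ).toBasis with hb
  set L := Submodule.span ℤ (Set.range b) with hL
  have hrank : Module.finrank ℤ L = d := by
    rw [ZLattice.rank ℝ L]; simp
  have hsum := ZLattice.summable_norm_rpow L (-(2 * s)) (by rw [hrank]; linarith)
  let e : (Fin d → ℤ) ≃ L := (b.restrictScalars ℤ).equivFun.symm.toEquiv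
  refine (e.summable_iff.2 hsum).congr fun n => ?_
  have h1 : ((e n : L) : EuclideanSpace ℝ (Fin d)) = WithLp.toLp 2 fun i => (n i : ℝ) := by
    ext i
    simp [e, Module.Basis.equivFun_symm_apply, hb, Finset.sum_apply, Pi.single_apply]
  have h2 : ‖e n‖ = Real.sqrt (∑ i, (n i : ℝ) ^ 2) := by
    rw [Submodule.coe_norm, h1, EuclideanSpace.norm_eq]
    simp
  simp only [Function.comp, h2, Real.sqrt_eq_rpow]
  rw [← Real.rpow_mul (by positivity)]
  congr 1; ring

theorem sum_sq_one_add_smul_mulVec {d : ℕ} (H : Matrix (Fin d) (Fin d) ℝ) (t : ℝ)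
    (x : Fin d → ℝ) :
    ∑ i, (((1 : Matrix (Fin d) (Fin d) ℝ) + t • H).mulVec x i) ^ 2 =
      ∑ i, x i ^ 2 + 2 * t * (x ⬝ᵥ H.mulVec x) + t ^ 2 * (x ⬝ᵥ (H.transpose * H).mulVec x) := by
  have e : x ⬝ᵥ (H.transpose * H).mulVec x = H.mulVec x ⬝ᵥ H.mulVec x := by
    rw [← Matrix.mulVec_mulVec, Matrix.dotProduct_mulVec, Matrix.vecMul_transpose]
  rw [e]
  simp only [dotProduct, Finset.mul_sum, ← Finset.sum_add_distrib]
  refine Finset.sum_congr rfl fun i _ => ?_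
  rw [Matrix.add_mulVec, Matrix.smul_mulVec, Matrix.one_mulVec]
  simp only [Pi.add_apply, Pi.smul_apply, smul_eq_mul]
  ring

/-- A weight invariant under permutations and sign changes of the coordinates has a scalar matrix
of second moments, so it averages a trace-free quadratic form to zero. -/
theorem tsum_mul_quadraticForm_eq_zero {d : ℕ} {W : (Fin d → ℤ) → ℝ}
    (hperm : ∀ n (σ : Equiv.Perm (Fin d)), W (n ∘ σ) = W n)
    (hneg : ∀ n i, W (Function.update n i (-n i)) = W n)
    (hsum : ∀ i j, Summable fun n => W n * ((n i : ℝ) * n j))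
    {H : Matrix (Fin d) (Fin d) ℝ} (hH : H.trace = 0) :
    ∑' n, W n * ((fun j => (n j : ℝ)) ⬝ᵥ H.mulVec fun j => (n j : ℝ)) = 0 := by
  set T : Fin d → Fin d → ℝ := fun i j => ∑' n, W n * ((n i : ℝ) * n j) with hT
  have hoff : ∀ i j, i ≠ j → T i j = 0 := by
    intro i j hij
    let e : Equiv.Perm (Fin d → ℤ) :=
      Function.Involutive.toPerm (fun n => Function.update n i (-n i)) fun n => by simp
    have h1 : T i j = -T i j := by
      rw [hT, ← tsum_neg]
      refine (e.tsum_eq _).symm.trans (tsum_congr fun n => ?_)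
      change W (Function.update n i (-n i)) * ((Function.update n i (-n i) i : ℤ) *
        (Function.update n i (-n i) j : ℤ)) = _
      simp [hneg, Function.update_of_ne hij.symm]
    linarith
  have hdiag : ∀ i j, T i i = T j j := by
    intro i j
    refine ((Equiv.arrowCongr (Equiv.swap i j) (Equiv.refl ℤ)).tsum_eq _).symm.trans
      (tsum_congr fun n => ?_)
    have : (Equiv.arrowCongr (Equiv.swap i j) (Equiv.refl ℤ)) n = n ∘ Equiv.swap i j := by
      ext k; simp [Equiv.arrowCongr]
    rw [this, hperm]
    simp
  have e1 : ∀ n : Fin d → ℤ, W n * ((fun j => (n j : ℝ)) ⬝ᵥ H.mulVec fun j => (n j : ℝ)) =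
      ∑ i, ∑ j, H i j * (W n * ((n i : ℝ) * n j)) := by
    intro n
    simp only [dotProduct, Matrix.mulVec, Finset.mul_sum]
    exact Finset.sum_congr rfl fun i _ => Finset.sum_congr rfl fun j _ => by ring
  refine (tsum_congr e1).trans ((Summable.tsum_finsetSum fun i _ =>
    summable_sum fun j _ => (hsum i j).mul_left (H i j)).trans ?_)
  have e2 : ∀ i, ∑' n, ∑ j, H i j * (W n * ((n i : ℝ) * n j)) = H i i * T i i := by
    intro i
    rw [Summable.tsum_finsetSum fun j _ => (hsum i j).mul_left _]
    simp_rw [tsum_mul_left]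
    exact Finset.sum_eq_single i (fun j _ hj => by
      rw [show ∑' n : Fin d → ℤ, W n * ((n i : ℝ) * n j) = T i j from rfl, hoff i j hj.symm,
        mul_zero]) (by simp)
  rw [Finset.sum_congr rfl fun i _ => e2 i]
  rcases isEmpty_or_nonempty (Fin d) with h | ⟨⟨k⟩⟩
  · simp
  · rw [Finset.sum_congr rfl fun i _ => by rw [hdiag i k], ← Finset.sum_mul]
    rw [show ∑ i, H i i = 0 from hH, zero_mul]

theorem one_le_sum_sq {d : ℕ} {n : Fin d → ℤ} (hn : n ≠ 0) : (1 : ℝ) ≤ ∑ i, (n i : ℝ) ^ 2 := by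
  obtain ⟨i, hi⟩ := Function.ne_iff.1 hn
  have hi : n i ≠ 0 := hi
  have h1 : (1 : ℤ) ≤ n i ^ 2 := Int.add_one_le_iff.2 (sq_pos_iff.2 hi)
  have h2 : (1 : ℝ) ≤ (n i : ℝ) ^ 2 := by exact_mod_cast h1
  exact h2.trans (Finset.single_le_sum (f := fun i => (n i : ℝ) ^ 2)
    (fun i _ => sq_nonneg _) (Finset.mem_univ i))

/-- The weighted lattice energy of a class `F` potential converges near the cubic lattice and is
critical there under trace-free deformations, provided the weight has the lattice's symmetries. -/
theorem InClassF.lattice_energy_critical {d : ℕ} {f : ℝ → ℝ} (hf : InClassF d f) {c : ℝ}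
    (hc : 0 < c) {χ : (Fin d → ℤ) → ℝ} (hχ : ∀ n, |χ n| ≤ 1)
    (hperm : ∀ n (σ : Equiv.Perm (Fin d)), χ (n ∘ σ) = χ n)
    (hneg : ∀ n i, χ (Function.update n i (-n i)) = χ n)
    {H : Matrix (Fin d) (Fin d) ℝ} (hH : H.trace = 0) (F : {n : Fin d → ℤ // n ≠ 0} → ℝ → ℝ)
    (hF : F = fun n t => χ n.1 * f (c * ∑ i, (((1 : Matrix (Fin d) (Fin d) ℝ) + t • H).mulVec
      (fun j => (n.1 j : ℝ)) i) ^ 2)) :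
    (∀ᶠ t in nhds 0, Summable fun n => F n t) ∧ HasDerivAt (fun t => ∑' n, F n t) 0 0 := by
  obtain ⟨f', hff', hb⟩ := hf.exists_deriv
  obtain ⟨s, σ, hs, hσ, ⟨C, hC, hfC⟩, ⟨D, hD, hfD⟩⟩ := hb (c / 2) (by positivity)
  have hs0 : 0 < s := lt_of_le_of_lt (by positivity) hs
  have hσ0 : 0 < σ := lt_of_le_of_lt (by positivity) hσ
  obtain ⟨K, hK, hBK⟩ := exists_abs_dotProduct_mulVec_le H
  obtain ⟨M, hM, hRM⟩ := exists_abs_dotProduct_mulVec_le (H.transpose * H)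
  set x : {n : Fin d → ℤ // n ≠ 0} → Fin d → ℝ := fun n j => (n.1 j : ℝ) with hx
  set Q := fun n => ∑ i, x n i ^ 2 with hQ
  set B := fun n => x n ⬝ᵥ H.mulVec (x n) with hB
  set R := fun n => x n ⬝ᵥ (H.transpose * H).mulVec (x n) with hR
  set q := fun n t => c * (Q n + 2 * t * B n + t ^ 2 * R n) with hq
  have hFq : ∀ n t, F n t = χ n.1 * f (q n t) := fun n t => by
    rw [hF]; simp only [hq, hQ, hB, hR, hx, sum_sq_one_add_smul_mulVec]
  have hQ1 : ∀ n, 1 ≤ Q n := fun n => one_le_sum_sq n.2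
  set ε : ℝ := (4 * K + 2 * M + 1)⁻¹ with hε
  have hden : 0 < 4 * K + 2 * M + 1 := by positivity
  have hε0 : 0 < ε := inv_pos.2 hden
  have hε1 : ε * (4 * K + 2 * M + 1) = 1 := inv_mul_cancel₀ hden.ne'
  have hεle : ε ≤ 1 := inv_le_one_of_one_le₀ (by linarith)
  have ht_abs : ∀ t ∈ Metric.ball (0 : ℝ) ε, |t| < ε := fun t ht => by simpa using ht
  have hq_lower : ∀ n, ∀ t ∈ Metric.ball (0 : ℝ) ε, c / 2 * Q n ≤ q n t := by
    intro n t ht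
    have ht := ht_abs t ht
    have h1 : |2 * t * B n| ≤ 2 * ε * (K * Q n) := by
      rw [abs_mul, abs_mul, abs_two]
      have := hBK (x n)
      gcongr
    have h2 : |t ^ 2 * R n| ≤ ε * (M * Q n) := by
      rw [abs_mul, abs_pow]
      have h3 : |t| ^ 2 ≤ ε := by nlinarith [abs_nonneg t]
      have := hRM (x n)
      gcongr
    have h3 : 2 * ε * (K * Q n) + ε * (M * Q n) ≤ 1 / 2 * Q n := by
      have : 2 * ε * K + ε * M ≤ 1 / 2 := by nlinarith
      nlinarith [hQ1 n]
    have h4 := neg_abs_le (2 * t * B n)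
    have h5 := neg_abs_le (t ^ 2 * R n)
    have : Q n / 2 ≤ Q n + 2 * t * B n + t ^ 2 * R n := by linarith
    calc c / 2 * Q n = c * (Q n / 2) := by ring
      _ ≤ _ := by simp only [hq]; gcongr
  have hcQ : ∀ n, c / 2 ≤ c / 2 * Q n := fun n => le_mul_of_one_le_right (by positivity) (hQ1 n)
  have hbd : ∀ (g : ℝ → ℝ) (A a : ℝ), 0 ≤ A → 0 ≤ a →
      (∀ r, c / 2 ≤ r → |g r| ≤ A * r ^ (-a)) → ∀ n, ∀ t ∈ Metric.ball (0 : ℝ) ε,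
      |χ n.1 * g (q n t)| ≤ A * (c / 2) ^ (-a) * Q n ^ (-a) := by
    intro g A a hA ha hg n t ht
    have hlow := hq_lower n t ht
    have hQn : 0 < Q n := one_pos.trans_le (hQ1 n)
    calc |χ n.1 * g (q n t)| ≤ |g (q n t)| := by
          rw [abs_mul]; exact mul_le_of_le_one_left (abs_nonneg _) (hχ _)
      _ ≤ A * q n t ^ (-a) := hg _ ((hcQ n).trans hlow)
      _ ≤ A * (c / 2 * Q n) ^ (-a) := by
          gcongr 1
          exact Real.rpow_le_rpow_of_nonpos (by positivity) hlow (by linarith)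
      _ = _ := by rw [Real.mul_rpow (by positivity) hQn.le, mul_assoc]
  have hsumQ : ∀ a : ℝ, (d : ℝ) / 2 < a → Summable fun n => Q n ^ (-a) := fun a ha =>
    (summable_sum_sq_rpow ha).comp_injective Subtype.val_injective
  have hsumF : ∀ t ∈ Metric.ball (0 : ℝ) ε, Summable fun n => F n t := by
    intro t ht
    refine Summable.of_norm_bounded ((hsumQ s hs).mul_left (C * (c / 2) ^ (-s))) fun n => ?_
    rw [hFq]
    exact hbd f C s hC hs0.le hfC n t ht
  have h0mem : (0 : ℝ) ∈ Metric.ball (0 : ℝ) ε := Metric.mem_ball_self hε0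
  refine ⟨Filter.eventually_of_mem (Metric.ball_mem_nhds 0 hε0) hsumF, ?_⟩
  set F' := fun n t => χ n.1 * f' (q n t) * (c * (2 * B n + 2 * t * R n)) with hF'
  have hderiv : ∀ n, ∀ t ∈ Metric.ball (0 : ℝ) ε, HasDerivAt (F n) (F' n t) t := by
    intro n t ht
    have hqpos : 0 < q n t :=
      lt_of_lt_of_le (by positivity) ((hcQ n).trans (hq_lower n t ht))
    have hqd : HasDerivAt (q n) (c * (2 * B n + 2 * t * R n)) t := by
      have h1 := (((hasDerivAt_id t).const_mul 2).mul_const (B n)).const_add (Q n)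
      have h2 := ((hasDerivAt_id t).pow 2).mul_const (R n)
      refine ((h1.add h2).const_mul c).congr_deriv ?_
      simp
    rw [show F n = fun t => χ n.1 * f (q n t) from funext (hFq n)]
    refine (((hff' _ hqpos).comp t hqd).const_mul (χ n.1)).congr_deriv ?_
    simp only [hF']; ring
  have hbound : ∀ n, ∀ t ∈ Metric.ball (0 : ℝ) ε, ‖F' n t‖ ≤
      D * (c / 2) ^ (-(1 + σ)) * (c * (2 * K + 2 * M)) * Q n ^ (-σ) := by
    intro n t ht
    have hQn : 0 < Q n := one_pos.trans_le (hQ1 n)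
    have h1 := hbd f' D (1 + σ) hD (by linarith) hfD n t ht
    have h2 : |c * (2 * B n + 2 * t * R n)| ≤ c * (2 * K + 2 * M) * Q n := by
      rw [abs_mul, abs_of_pos hc, mul_assoc c]
      refine mul_le_mul_of_nonneg_left ?_ hc.le
      have k1 : |2 * B n| ≤ 2 * (K * Q n) := by
        rw [abs_mul, abs_two]
        have := hBK (x n)
        gcongr
      have k2 : |2 * t * R n| ≤ 2 * 1 * (M * Q n) := by
        rw [abs_mul, abs_mul, abs_two]
        have := hRM (x n)
        have := (ht_abs t ht).le.trans hεle
        gcongr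
      linarith [abs_add_le (2 * B n) (2 * t * R n)]
    rw [Real.norm_eq_abs, hF', abs_mul]
    refine (mul_le_mul h1 h2 (abs_nonneg _) (by positivity)).trans (le_of_eq ?_)
    rw [show Q n ^ (-σ) = Q n ^ (-(1 + σ)) * Q n by
      rw [← Real.rpow_add_one hQn.ne']; congr 1; ring]
    ring
  have main := hasDerivAt_tsum_of_isPreconnected ((hsumQ σ hσ).mul_left _) Metric.isOpen_ball
    (convex_ball (0 : ℝ) ε).isPreconnected hderiv hbound h0mem (hsumF 0 h0mem) h0mem
  refine main.congr_deriv ?_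
  set W : (Fin d → ℤ) → ℝ := fun n => χ n * f' (c * ∑ i, (n i : ℝ) ^ 2) with hW
  have hWq : ∀ n : {n : Fin d → ℤ // n ≠ 0}, W n.1 = χ n.1 * f' (q n 0) := fun n => by
    simp [hW, hq, hQ, hx]
  have hF'0 : ∀ n : {n : Fin d → ℤ // n ≠ 0}, F' n 0 = 2 * c *
      (W n.1 * ((fun j => (n.1 j : ℝ)) ⬝ᵥ H.mulVec fun j => (n.1 j : ℝ))) := fun n => by
    rw [hWq]; simp only [hF', hB, hx]; ring
  simp_rw [hF'0]
  rw [tsum_mul_left]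
  refine mul_eq_zero_of_right _ ((tsum_subtype_eq_of_support_subset
    (s := {n : Fin d → ℤ | n ≠ 0})
    (f := fun n => W n * ((fun j => (n j : ℝ)) ⬝ᵥ H.mulVec fun j => (n j : ℝ))) ?_).trans
    (tsum_mul_quadraticForm_eq_zero ?_ ?_ ?_ hH))
  · intro n hn h0
    subst h0
    simp [dotProduct] at hn
  · intro n τ
    simp only [hW, hperm, Function.comp]
    rw [Equiv.sum_comp τ fun i => (n i : ℝ) ^ 2]
  · intro n i
    simp only [hW, hneg]
    congr 3
    refine Finset.sum_congr rfl fun j _ => ?_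
    rcases eq_or_ne j i with rfl | hj
    · simp
    · simp [Function.update_of_ne hj]
  · intro i j
    refine Summable.of_norm_bounded ((summable_sum_sq_rpow hσ).mul_left
      (D * (c / 2) ^ (-(1 + σ)))) fun n => ?_
    rcases eq_or_ne n 0 with rfl | hn
    · simp [hσ0.ne']
    · have h1 := hbd f' D (1 + σ) hD (by linarith) hfD ⟨n, hn⟩ 0 h0mem
      rw [← hWq] at h1
      have hQn : 0 < ∑ i, (n i : ℝ) ^ 2 := one_pos.trans_le (one_le_sum_sq hn)
      have hle : ∀ i, (n i : ℝ) ^ 2 ≤ ∑ i, (n i : ℝ) ^ 2 := fun i =>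
        Finset.single_le_sum (f := fun i => (n i : ℝ) ^ 2) (fun i _ => sq_nonneg _)
          (Finset.mem_univ i)
      have h2 : |(n i : ℝ) * n j| ≤ ∑ i, (n i : ℝ) ^ 2 := by
        refine abs_le.2 ⟨?_, ?_⟩ <;>
          nlinarith [hle i, hle j, sq_nonneg ((n i : ℝ) + n j), sq_nonneg ((n i : ℝ) - n j)]
      rw [Real.norm_eq_abs, abs_mul]
      refine (mul_le_mul h1 h2 (abs_nonneg _) (by positivity)).trans (le_of_eq ?_)
      rw [show (∑ i, (n i : ℝ) ^ 2) ^ (-σ) =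
          (∑ i, (n i : ℝ) ^ 2) ^ (-(1 + σ)) * ∑ i, (n i : ℝ) ^ 2 by
        rw [← Real.rpow_add_one hQn.ne']; congr 1; ring]
      simp only [hQ, hx]
      ring

/-- Criticality of the rock-salt structure `V^{1/d}ℤ^d` with alternating charges:
for every trace-free deformation direction `H`, the energy of the deformed lattice
`(I + tH)·V^{1/d}ℤ^d` has vanishing derivative at `t = 0`. -/
theorem rocksalt_critical_point
    (d : ℕ) (hd : 1 ≤ d) (V : ℝ) (hV : 0 < V)
    (f₁ f₂ : ℝ → ℝ) (hf₁ : InClassF d f₁) (hf₂ : InClassF d f₂)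
    (H : Matrix (Fin d) (Fin d) ℝ) (hH : Matrix.trace H = 0) :
    HasDerivAt (fun t : ℝ =>
      ∑' n : {n : Fin d → ℤ // n ≠ 0},
        (f₁ (V ^ ((2 : ℝ) / d) *
            ∑ i, (((1 : Matrix (Fin d) (Fin d) ℝ) + t • H).mulVec
                    (fun j => ((n.1 j : ℝ))) i) ^ 2)
          + (-1 : ℝ) ^ (∑ i, n.1 i) *
            f₂ (V ^ ((2 : ℝ) / d) *
              ∑ i, (((1 : Matrix (Fin d) (Fin d) ℝ) + t • H).mulVec
                      (fun j => ((n.1 j : ℝ))) i) ^ 2)))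
      0 0 := by
  have hc : 0 < V ^ ((2 : ℝ) / d) := Real.rpow_pos_of_pos hV _
  obtain ⟨hs₁, hd₁⟩ := hf₁.lattice_energy_critical hc (χ := fun _ => 1) (by simp) (by simp)
    (by simp) hH _ rfl
  obtain ⟨hs₂, hd₂⟩ := hf₂.lattice_energy_critical hc (χ := fun n => (-1 : ℝ) ^ ∑ i, n i)
    (by simp [abs_zpow]) (fun n σ => by simp only [Function.comp, Equiv.sum_comp σ n])
    (fun n i => by
      have h : ∀ j, Function.update n i (-n i) j =
          n j + Pi.single (M := fun _ => ℤ) i (2 * -n i) j := by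
        intro j
        rcases eq_or_ne j i with rfl | hj
        · simp; ring
        · simp [hj]
      simp only [h, Finset.sum_add_distrib]
      rw [zpow_add₀ (by norm_num), Finset.sum_pi_single', if_pos (Finset.mem_univ i), zpow_mul]
      simp) hH _ rfl
  refine ((hd₁.add hd₂).congr_deriv (add_zero 0)).congr_of_eventuallyEq ?_
  filter_upwards [hs₁, hs₂] with t h₁ h₂
  simp only [Pi.add_apply]
  rw [← h₁.tsum_add h₂]
  simp only [one_mul]
end
end

section
/- Let d ≥ 1 and p > q > d/2. There exists V₀ > 0, depending only on p, q, d, such that for all 0 < V < V₀ the rock-salt structure is the unique minimizer among orthorhombic lattices of covolume V equipped with arbitrary periodic charge distributions: for every a ∈ (0,∞)^d with a₁⋯a_d = 1, every integer N ≥ 1, and every φ ∈ Λ_N, one has E_{p,q}[V^{1/d}L_a, φ] ≥ E_{p,q}[V^{1/d}ℤ^d, φ_±], where φ_±(n) = (−1)^{n₁+⋯+n_d}; moreover equality holds if and only if N is even, a = (1,…,1) and φ(n) = (−1)^{n₁+⋯+n_d} for all n ∈ ℤ^d. -/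
noncomputable section

/-- Quadratic form of the orthorhombic lattice `L_a = a₁ℤ × ⋯ × a_dℤ`:
`Q_a(n) = a₁²n₁² + ⋯ + a_d²n_d²`. -/
def Qf (d : ℕ) (a : Fin d → ℝ) (n : Fin d → ℤ) : ℝ :=
  ∑ i, (a i) ^ 2 * (n i : ℝ) ^ 2

/-- The alternating charge distribution `φ_±(n) = (-1)^{n₁+⋯+n_d}`. -/
def altSign (d : ℕ) (n : Fin d → ℤ) : ℝ := (-1 : ℝ) ^ (∑ i, n i)

/-- `φ ∈ Λ_N`: an `N`-periodic charge distribution on `ℤ^d` with `φ(0) > 0` and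
`L²`-normalization `Σ_{m ∈ {0,…,N-1}^d} φ(m)² = N^d`. -/
def IsChargeDist (d N : ℕ) (φ : (Fin d → ℤ) → ℝ) : Prop :=
  (∀ n : Fin d → ℤ, ∀ i : Fin d, φ (n + Pi.single i (N : ℤ)) = φ n) ∧
  0 < φ 0 ∧
  ∑ m : Fin d → Fin N, (φ (fun i => (m i : ℤ))) ^ 2 = (N : ℝ) ^ d

/-- The inverse-power-law energy `E_{p,q}[V^{1/d}L_a, φ]` of the orthorhombic
lattice `V^{1/d}L_a` with `N`-periodic charge distribution `φ`. -/
def Energy (d : ℕ) (p q V : ℝ) (a : Fin d → ℝ) (N : ℕ) (φ : (Fin d → ℤ) → ℝ) : ℝ :=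
  (∑' n : {n : Fin d → ℤ // n ≠ 0}, (V ^ ((2 : ℝ) / d) * Qf d a n.1) ^ (-p))
  + ((N : ℝ) ^ d)⁻¹ *
      ∑' n : {n : Fin d → ℤ // n ≠ 0},
        ∑ m : Fin d → Fin N,
          φ (fun i => (m i : ℤ)) * φ ((fun i => (m i : ℤ)) + n.1) *
            (V ^ ((2 : ℝ) / d) * Qf d a n.1) ^ (-q)

section Auxiliary

open Real HurwitzZeta MeasureTheory

lemma exp_mul_sq_le_cosh {c w : ℝ} (hc : 6 ≤ c) (hw : |w| ≤ 1 / 2) :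
    exp (c * w ^ 2) ≤ cosh (c * w) := by
  wlog h0 : 0 ≤ w generalizing w
  · have := @this (-w) (by rwa [abs_neg]) (by linarith)
    simpa using this
  rw [abs_of_nonneg h0] at hw
  by_cases hx : c * w ≤ 7 / 5
  · set x := c * w with hxdef
    have hx0 : 0 ≤ x := by positivity
    have h1 : c * w ^ 2 ≤ x ^ 2 / 6 := by
      have : w ≤ x / 6 := by rw [hxdef]; nlinarith
      calc c * w ^ 2 = x * w := by rw [hxdef]; ring
        _ ≤ x * (x / 6) := by gcongr
        _ = x ^ 2 / 6 := by ring
    have h2 : x ^ 2 ≤ 2 := by nlinarith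
    have h3 : exp (x ^ 2 / 6) ≤ 1 / (1 - x ^ 2 / 6) := Real.exp_bound_div_one_sub_of_interval (by positivity) (by linarith)
    have h4 : 1 / (1 - x ^ 2 / 6) ≤ 1 + x ^ 2 / 2 := by
      rw [div_le_iff₀ (by linarith)]; nlinarith [sq_nonneg x]
    have h5 : 1 + x ^ 2 / 2 ≤ cosh x := by
      have e : cosh x = 1 + 2 * sinh (x / 2) ^ 2 := by
        have := Real.cosh_two_mul (x / 2)
        rw [Real.cosh_sq] at this
        rw [show x = 2 * (x / 2) by ring, this]; ring_nf
      have s := Real.self_le_sinh_iff.2 (show 0 ≤ x / 2 by positivity)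
      have : (x / 2) ^ 2 ≤ sinh (x / 2) ^ 2 := by gcongr
      rw [e]; nlinarith
    calc exp (c * w ^ 2) ≤ exp (x ^ 2 / 6) := by gcongr
      _ ≤ _ := h3.trans (h4.trans h5)
  · push Not at hx
    have h1 : c * w ^ 2 ≤ c * w / 2 := by nlinarith
    have h2 : (2 : ℝ) ≤ exp (c * w / 2) := by
      calc (2 : ℝ) ≤ exp (7 / 10) := by
            have h : (1 + 7 / 30 + (7 / 30) ^ 2 / 2 : ℝ) ≤ exp (7 / 30) :=
              Real.quadratic_le_exp_of_nonneg (by norm_num)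
            calc (2 : ℝ) ≤ (1 + 7 / 30 + (7 / 30) ^ 2 / 2) ^ 3 := by norm_num
              _ ≤ exp (7 / 30) ^ 3 := by gcongr
              _ = exp (7 / 10) := by rw [← Real.exp_nat_mul]; norm_num
        _ ≤ _ := Real.exp_le_exp.2 (by linarith)
    have h3 : exp (c * w) = exp (c * w / 2) * exp (c * w / 2) := by rw [← Real.exp_add]; ring_nf
    calc exp (c * w ^ 2) ≤ exp (c * w / 2) := by gcongr
      _ ≤ exp (c * w) / 2 := by rw [h3]; nlinarith [exp_pos (c * w / 2)]
      _ ≤ cosh (c * w) := by rw [cosh_eq]; linarith [exp_pos (-(c * w))]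

lemma exp_neg_three_pi_half_le : exp (-(3 * π / 2)) ≤ 1 / 64 := by
  rw [Real.exp_neg, ← one_div]
  apply one_div_le_one_div_of_le (by norm_num)
  have h : (64 : ℝ) ≤ exp (3 / 2) ^ 3 := by
    have h2 : (4 : ℝ) ≤ exp (3 / 2) := by
      have := Real.quadratic_le_exp_of_nonneg (x := 3 / 4) (by norm_num)
      rw [show (3 / 2 : ℝ) = 3 / 4 + 3 / 4 by norm_num, Real.exp_add]
      nlinarith
    calc (64 : ℝ) = 4 ^ 3 := by norm_num
      _ ≤ _ := by gcongr
  calc (64 : ℝ) ≤ _ := h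
    _ = exp (9 / 2) := by rw [← Real.exp_nat_mul]; norm_num
    _ ≤ _ := by gcongr; linarith [pi_gt_three]

lemma sq_mul_exp_le (n : ℕ) {t : ℝ} (ht : 1 / 2 ≤ t) :
    ((n : ℝ) + 1) ^ 2 * exp (-π * (n + 1) ^ 2 * t) ≤ exp (-π * t) * (1 / 16) ^ n := by
  have h1 : ((n : ℝ) + 1) ^ 2 ≤ 4 ^ n := by
    have : (n + 1) ≤ 2 ^ n := Nat.lt_two_pow_self
    have h : ((n : ℝ) + 1) ≤ 2 ^ n := by exact_mod_cast this
    calc ((n : ℝ) + 1) ^ 2 ≤ (2 ^ n) ^ 2 := by gcongr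
      _ = 4 ^ n := by rw [← pow_mul, mul_comm, pow_mul]; norm_num
  have hn : (n : ℝ) ≤ n ^ 2 := by exact_mod_cast Nat.le_self_pow (by norm_num) n
  have h2 : exp (-π * (n + 1) ^ 2 * t) ≤ exp (-π * t) * (1 / 64) ^ n := by
    calc exp (-π * (n + 1) ^ 2 * t) ≤ exp (-π * t + n * (-(3 * π / 2))) := by
          gcongr
          have : (3 * n : ℝ) * (1 / 2) ≤ (n ^ 2 + 2 * n) * t := by gcongr; linarith
          nlinarith [mul_le_mul_of_nonneg_left this pi_pos.le]
      _ = exp (-π * t) * exp (-(3 * π / 2)) ^ n := by rw [Real.exp_add, Real.exp_nat_mul]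
      _ ≤ _ := by gcongr; exact exp_neg_three_pi_half_le
  calc _ ≤ (4 : ℝ) ^ n * (exp (-π * t) * (1 / 64) ^ n) := by gcongr
    _ = exp (-π * t) * (4 * (1 / 64)) ^ n := by rw [mul_pow]; ring
    _ = _ := by norm_num

lemma abs_sin_nat_mul_le (m : ℕ) (x : ℝ) : |sin (m * x)| ≤ m * |sin x| := by
  induction m with
  | zero => simp
  | succ m ih =>
    push_cast
    rw [add_mul, one_mul, sin_add]
    calc _ ≤ |sin (m * x) * cos x| + |cos (m * x) * sin x| := abs_add_le _ _
      _ ≤ |sin (m * x)| * 1 + 1 * |sin x| := by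
        rw [abs_mul, abs_mul]; gcongr <;> exact abs_cos_le_one _
      _ ≤ _ := by linarith

lemma one_sub_cos_nat_mul_le (m : ℕ) (x : ℝ) : 1 - cos (m * x) ≤ m ^ 2 * (1 - cos x) := by
  have h := abs_sin_nat_mul_le m (x / 2)
  have e (y : ℝ) : 1 - cos y = 2 * |sin (y / 2)| ^ 2 := by
    have := cos_two_mul (y / 2)
    rw [cos_sq', show 2 * (y / 2) = y by ring] at this
    rw [sq_abs]; linarith
  rw [e, e, show m * x / 2 = m * (x / 2) by ring]
  have := pow_le_pow_left₀ (abs_nonneg _) h 2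
  nlinarith

lemma cosKernel_half_gap {x t : ℝ} (ht : 1 / 2 ≤ t) :
    (1 + cos (2 * π * x)) * exp (-π * t) ≤
      cosKernel (x : UnitAddCircle) t - cosKernel ((1 / 2 : ℝ) : UnitAddCircle) t := by
  have ht0 : 0 < t := by linarith
  have H := (hasSum_nat_cosKernel₀ x ht0).sub (hasSum_nat_cosKernel₀ (1 / 2) ht0)
  have hr : HasSum (fun n : ℕ => 2 * (1 + cos (2 * π * x)) * exp (-π * t) *
      ((if n = 0 then 2 else 0) - (1 / 16 : ℝ) ^ n))
      (2 * (1 + cos (2 * π * x)) * exp (-π * t) * (2 - (1 - 1 / 16)⁻¹)) := by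
    apply HasSum.mul_left
    exact (hasSum_ite_eq 0 (2 : ℝ)).sub (hasSum_geometric_of_lt_one (by norm_num) (by norm_num))
  have hc : 0 ≤ 1 + cos (2 * π * x) := by linarith [neg_one_le_cos (2 * π * x)]
  have key := hasSum_le (fun n => ?_) hr H
  · have : 0 ≤ (1 + cos (2 * π * x)) * exp (-π * t) := by positivity
    norm_num at key this ⊢
    nlinarith
  · set θ := 2 * π * x - π with hθ
    have e1 : 1 + cos (2 * π * x) = 1 - cos θ := by rw [hθ, cos_sub_pi]; ring
    have e2 : cos (2 * π * x * (n + 1)) = -((-1) ^ n * cos ((n + 1 : ℕ) * θ)) := by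
      rw [show 2 * π * x * (n + 1) = (n + 1 : ℕ) * θ + (n + 1 : ℕ) * π by rw [hθ]; push_cast; ring,
        cos_add_nat_mul_pi, pow_succ]
      ring
    have e3 : cos (2 * π * (1 / 2) * (n + 1)) = -(-1) ^ n := by
      rw [show 2 * π * (1 / 2) * (n + 1) = (n + 1 : ℕ) * π by push_cast; ring, cos_nat_mul_pi,
        pow_succ]
      ring
    rw [e1] at hc ⊢
    rw [e2, e3]
    have h1 := one_sub_cos_nat_mul_le (n + 1) θ
    have h2 := sq_mul_exp_le n ht
    have h3 : 0 ≤ 1 - cos ((n + 1 : ℕ) * θ) := by linarith [cos_le_one ((n + 1 : ℕ) * θ)]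
    rcases n with _ | n
    · norm_num
      linarith
    · simp only [Nat.add_eq_zero_iff, one_ne_zero, and_false, if_false]
      set E := exp (-π * ((n + 1 : ℕ) + 1) ^ 2 * t)
      have hE : 0 < E := exp_pos _
      set D := cos ((n + 1 + 1 : ℕ) * θ)
      have h4 : (1 - D) * E ≤ (1 - cos θ) * (exp (-π * t) * (1 / 16) ^ (n + 1)) := by
        calc (1 - D) * E ≤ ((n + 1 + 1 : ℕ) ^ 2 * (1 - cos θ)) * E := by gcongr
          _ = (1 - cos θ) * (((n + 1 : ℕ) + 1) ^ 2 * E) := by push_cast; ring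
          _ ≤ _ := by gcongr
      have h5 : 0 ≤ (1 - D) * E := by positivity
      rcases neg_one_pow_eq_or ℝ (n + 1) with h | h <;> rw [h] <;> nlinarith

lemma evenKernel_half_le {x y : ℝ} (hy : 2 ≤ y) :
    evenKernel ((1 / 2 : ℝ) : UnitAddCircle) y ≤ evenKernel (x : UnitAddCircle) y := by
  wlog hx : 0 ≤ x ∧ x ≤ 1 generalizing x
  · have := @this (Int.fract x) ⟨Int.fract_nonneg x, (Int.fract_lt_one x).le⟩
    have e : ((Int.fract x : ℝ) : UnitAddCircle) = (x : UnitAddCircle) := by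
      exact AddCircle.coe_fract x
    rwa [e] at this
  have hy0 : 0 < y := by linarith
  have refl (a : ℝ) : HasSum (fun n : ℤ => exp (-π * (n + a) ^ 2 * y) + exp (-π * (((-1 - n : ℤ)) + a) ^ 2 * y))
      (evenKernel (a : UnitAddCircle) y + evenKernel (a : UnitAddCircle) y) :=
    (hasSum_int_evenKernel a hy0).add
      (((Equiv.subLeft (-1 : ℤ)).hasSum_iff).2 (hasSum_int_evenKernel a hy0))
  have key := hasSum_le (fun n => ?_) (refl (1 / 2)) (refl x)
  · linarith
  set w := x - 1 / 2 with hw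
  have hw' : |w| ≤ 1 / 2 := by rw [abs_le]; constructor <;> linarith
  set c := π * y
  have hc : 6 ≤ c := by nlinarith [pi_gt_three]
  set k : ℝ := 2 * n + 1 with hk
  have hk1 : 1 ≤ |k| := by
    have : (1 : ℤ) ≤ |2 * n + 1| := Int.one_le_abs (by omega)
    rw [hk]; exact_mod_cast this
  have hcosh : exp (c * w ^ 2) ≤ cosh (k * (c * w)) := by
    refine (exp_mul_sq_le_cosh hc hw').trans (Real.cosh_le_cosh.2 ?_)
    rw [abs_mul k]
    nlinarith [abs_nonneg (c * w)]
  have eL : exp (-π * (n + 1 / 2) ^ 2 * y) + exp (-π * (((-1 - n : ℤ)) + 1 / 2) ^ 2 * y)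
      = 2 * exp (-(c * k ^ 2 / 4)) := by
    rw [two_mul]; congr 2 <;> push_cast <;> simp only [hk, c] <;> ring
  have eR : exp (-π * (n + x) ^ 2 * y) + exp (-π * (((-1 - n : ℤ)) + x) ^ 2 * y)
      = 2 * exp (-(c * k ^ 2 / 4)) * (exp (-(c * w ^ 2)) * cosh (k * (c * w))) := by
    rw [cosh_eq, show ∀ A B X Y : ℝ, 2 * A * (B * ((X + Y) / 2)) = A * B * Y + A * B * X by intros; ring]
    simp only [← Real.exp_add]
    congr 2 <;> push_cast <;> simp only [hk, c, hw] <;> ring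
  rw [eL, eR]
  have : 1 ≤ exp (-(c * w ^ 2)) * cosh (k * (c * w)) := by
    rw [Real.exp_neg, ← div_eq_inv_mul, le_div_iff₀ (exp_pos _)]; linarith
  nlinarith [exp_pos (-(c * k ^ 2 / 4))]

lemma cosKernel_eq_evenKernel (a : UnitAddCircle) {t : ℝ} (ht : 0 < t) :
    cosKernel a t = (1 / t) ^ (1 / 2 : ℝ) * evenKernel a (1 / t) := by
  rw [evenKernel_functional_equation]
  have : ((1 / t) ^ (1 / 2 : ℝ)) ≠ 0 := by positivity
  field_simp

lemma cosKernel_half_le (x : ℝ) {t : ℝ} (ht : 0 < t) :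
    cosKernel ((1 / 2 : ℝ) : UnitAddCircle) t ≤ cosKernel (x : UnitAddCircle) t := by
  rcases le_total (1 / 2) t with h | h
  · have := cosKernel_half_gap (x := x) h
    have : 0 ≤ (1 + cos (2 * π * x)) * exp (-π * t) := 
      mul_nonneg (by linarith [neg_one_le_cos (2 * π * x)]) (exp_pos _).le
    linarith
  · rw [cosKernel_eq_evenKernel _ ht, cosKernel_eq_evenKernel _ ht]
    gcongr
    apply evenKernel_half_le
    rw [le_div_iff₀ ht]; linarith

lemma cosKernel_pos (x : ℝ) {t : ℝ} (ht : 0 < t) : 0 < cosKernel (x : UnitAddCircle) t := by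
  rw [cosKernel_eq_evenKernel _ ht]
  have h := hasSum_int_evenKernel x (one_div_pos.2 ht)
  have : 0 < evenKernel (x : UnitAddCircle) (1 / t) := by
    rw [← h.tsum_eq]
    exact h.summable.tsum_pos (fun n => (exp_pos _).le) 0 (exp_pos _)
  positivity

/-- The weighted theta sum `∑ₙ (π n²)ʲ exp (-π n² t)`. -/
def thetaMoment (j : ℕ) (t : ℝ) : ℝ := ∑' n : ℤ, (π * n ^ 2) ^ j * exp (-π * n ^ 2 * t)

lemma hasSum_theta {t : ℝ} (ht : 0 < t) :
    HasSum (fun n : ℤ => exp (-π * n ^ 2 * t)) (cosKernel 0 t) := by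
  have := hasSum_int_evenKernel 0 ht
  simp only [add_zero] at this
  rw [← evenKernel_eq_cosKernel_of_zero]
  exact_mod_cast this

lemma summable_thetaMoment (j : ℕ) {t : ℝ} (ht : 0 < t) :
    Summable (fun n : ℤ => (π * (n : ℝ) ^ 2) ^ j * exp (-π * n ^ 2 * t)) := by
  refine Summable.of_nonneg_of_le (fun n => by positivity) (fun n => ?_)
    ((hasSum_theta (half_pos ht)).summable.mul_left (j.factorial * (2 / t) ^ j))
  set y := π * (n : ℝ) ^ 2
  have hy : 0 ≤ y := by positivity
  have h := Real.pow_div_factorial_le_exp (x := y * (t / 2)) (by positivity) j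
  rw [div_le_iff₀ (by positivity)] at h
  have e1 : exp (-π * n ^ 2 * t) = exp (-(y * (t / 2))) * exp (-π * n ^ 2 * (t / 2)) := by
    rw [← Real.exp_add]; congr 1; simp only [y]; ring
  have e2 : y ^ j = (2 / t) ^ j * (y * (t / 2)) ^ j := by
    rw [← mul_pow]; congr 1; field_simp
  calc y ^ j * exp (-π * n ^ 2 * t)
      ≤ (2 / t) ^ j * (exp (y * (t / 2)) * j.factorial) *
        (exp (-(y * (t / 2))) * exp (-π * n ^ 2 * (t / 2))) := by
        rw [e1, e2]; gcongr
    _ = (exp (y * (t / 2)) * exp (-(y * (t / 2)))) *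
        (j.factorial * (2 / t) ^ j * exp (-π * n ^ 2 * (t / 2))) := by ring
    _ = _ := by rw [← Real.exp_add, add_neg_cancel, Real.exp_zero, one_mul]

lemma thetaMoment_zero {t : ℝ} (ht : 0 < t) : thetaMoment 0 t = cosKernel 0 t := by
  simp only [thetaMoment, pow_zero, one_mul]
  exact (hasSum_theta ht).tsum_eq

lemma hasDerivAt_thetaMoment (j : ℕ) {t : ℝ} (ht : 0 < t) :
    HasDerivAt (thetaMoment j) (-thetaMoment (j + 1) t) t := by
  have := hasDerivAt_tsum_of_isPreconnected (𝕜 := ℝ) (F := ℝ) (summable_thetaMoment (j + 1) (half_pos ht))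
    (isOpen_Ioi (a := t / 2)) isPreconnected_Ioi (y₀ := t) (y := t)
    (g := fun (n : ℤ) y => (π * (n : ℝ) ^ 2) ^ j * exp (-π * n ^ 2 * y))
    (g' := fun (n : ℤ) y => -((π * (n : ℝ) ^ 2) ^ (j + 1) * exp (-π * n ^ 2 * y)))
    (fun n y _ => by
      have := ((((hasDerivAt_id y).const_mul (-π * (n : ℝ) ^ 2)).exp).const_mul ((π * (n : ℝ) ^ 2) ^ j))
      convert! this using 1
      simp only [id]; ring)
    (fun n y hy => by
      rw [norm_neg, Real.norm_of_nonneg (by positivity)]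
      refine mul_le_mul_of_nonneg_left (Real.exp_le_exp.2 ?_) (by positivity)
      have : t / 2 ≤ y := le_of_lt hy
      have h2 : 0 ≤ π * (n : ℝ) ^ 2 := by positivity
      nlinarith)
    (by simp [ht]) (summable_thetaMoment j ht) (by simp [ht])
  rw [tsum_neg] at this
  exact this

lemma thetaMoment_pos (j : ℕ) {t : ℝ} (ht : 0 < t) : 0 < thetaMoment j t :=
  (summable_thetaMoment j ht).tsum_pos (fun n => by positivity) 1 (by norm_num; positivity)

lemma one_le_thetaMoment_zero {t : ℝ} (ht : 0 < t) : 1 ≤ thetaMoment 0 t := by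
  have := (summable_thetaMoment 0 ht).le_tsum 0 (fun n _ => by positivity)
  simpa [thetaMoment] using this

lemma pi_mul_thetaMoment_one_le {t : ℝ} (ht : 0 < t) :
    π * thetaMoment 1 t ≤ thetaMoment 2 t := by
  rw [thetaMoment, ← tsum_mul_left]
  refine Summable.tsum_le_tsum (fun n => ?_) ((summable_thetaMoment 1 ht).mul_left π) (summable_thetaMoment 2 ht)
  rw [← mul_assoc]
  gcongr
  rcases eq_or_ne n 0 with rfl | hn
  · simp
  · have : (1 : ℝ) ≤ n ^ 2 := by
      have : 1 ≤ n ^ 2 := Int.one_le_abs (pow_ne_zero 2 hn) |>.trans_eq (abs_of_nonneg (sq_nonneg n))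
      exact_mod_cast this
    have h3 : π ≤ π * n ^ 2 := by nlinarith [pi_pos]
    calc π * (π * n ^ 2) ^ 1 ≤ (π * n ^ 2) * (π * n ^ 2) := by rw [pow_one]; gcongr
      _ = _ := by ring

lemma thetaMoment_one_lt {t : ℝ} (ht : 1 ≤ t) : thetaMoment 1 t < 1 := by
  have ht0 : 0 < t := by linarith
  have h := (summable_thetaMoment 1 ht0).hasSum.nat_add_neg
  rw [← hasSum_nat_add_iff' 1] at h
  have hg := (hasSum_geometric_of_lt_one (r := (1 / 16 : ℝ)) (by norm_num) (by norm_num)).mul_left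
    (2 * π * exp (-π * t))
  have key := hasSum_le (fun n => ?_) h hg
  · have e : thetaMoment 1 t ≤ 2 * π * exp (-π * t) * (1 - 1 / 16)⁻¹ := by
      simpa [thetaMoment] using key
    have h8 : exp (-π * t) ≤ 1 / 8 := by
      rw [neg_mul, Real.exp_neg, ← one_div]
      apply one_div_le_one_div_of_le (by norm_num)
      have h2 : (2 : ℝ) ≤ exp 1 := by linarith [Real.add_one_le_exp 1]
      calc (8 : ℝ) = 2 ^ 3 := by norm_num
        _ ≤ exp 1 ^ 3 := by gcongr
        _ = exp 3 := by rw [← Real.exp_nat_mul]; norm_num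
        _ ≤ _ := Real.exp_le_exp.2 (by nlinarith [pi_gt_three])
    have := pi_lt_d2
    norm_num at e h8 this ⊢
    nlinarith [pi_pos]
  · have := sq_mul_exp_le n (t := t) (by linarith)
    push_cast at this ⊢
    simp only [neg_sq]
    nlinarith [pi_pos]

/-- The logarithm of the theta function in the logarithmic variable. -/
def logTheta (u : ℝ) : ℝ := log (cosKernel 0 (exp u))

def logThetaDeriv (u : ℝ) : ℝ := -(exp u * thetaMoment 1 (exp u)) / thetaMoment 0 (exp u)

def logThetaDeriv₂ (u : ℝ) : ℝ :=
  exp u * (exp u * thetaMoment 2 (exp u) * thetaMoment 0 (exp u)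
    - thetaMoment 1 (exp u) * thetaMoment 0 (exp u)
    - exp u * thetaMoment 1 (exp u) ^ 2) / thetaMoment 0 (exp u) ^ 2

lemma hasDerivAt_thetaMoment_exp (j : ℕ) (u : ℝ) :
    HasDerivAt (fun u => thetaMoment j (exp u)) (-thetaMoment (j + 1) (exp u) * exp u) u :=
  (hasDerivAt_thetaMoment j (exp_pos u)).comp u (Real.hasDerivAt_exp u)

lemma hasDerivAt_logTheta (u : ℝ) : HasDerivAt logTheta (logThetaDeriv u) u := by
  have h := (hasDerivAt_thetaMoment_exp 0 u).log (thetaMoment_pos 0 (exp_pos u)).ne'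
  have e : logTheta = fun u => log (thetaMoment 0 (exp u)) := by
    funext v; rw [logTheta, thetaMoment_zero (exp_pos v)]
  rw [e]
  convert! h using 1
  rw [logThetaDeriv]; ring

lemma hasDerivAt_logThetaDeriv (u : ℝ) : HasDerivAt logThetaDeriv (logThetaDeriv₂ u) u := by
  have h0 := (thetaMoment_pos 0 (exp_pos u)).ne'
  have h := ((((Real.hasDerivAt_exp u).mul (hasDerivAt_thetaMoment_exp 1 u)).neg).div
    (hasDerivAt_thetaMoment_exp 0 u) h0)
  convert! h using 1
  rw [logThetaDeriv₂]
  simp only [Pi.neg_apply, Pi.mul_apply]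
  congr 1
  ring

lemma continuous_logThetaDeriv₂ : Continuous logThetaDeriv₂ := by
  have h (j : ℕ) : Continuous fun u => thetaMoment j (exp u) :=
    continuous_iff_continuousAt.2 fun u => (hasDerivAt_thetaMoment_exp j u).continuousAt
  unfold logThetaDeriv₂
  have h0 := h 0
  have h1 := h 1
  have h2 := h 2
  refine Continuous.div ?_ (h0.pow 2) (fun u => pow_ne_zero 2 (thetaMoment_pos 0 (exp_pos u)).ne')
  fun_prop

lemma logThetaDeriv₂_pos {u : ℝ} (hu : 0 ≤ u) : 0 < logThetaDeriv₂ u := by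
  have ht : 1 ≤ exp u := Real.one_le_exp hu
  have h0 := one_le_thetaMoment_zero (exp_pos u)
  have h1 := thetaMoment_one_lt ht
  have h1' := thetaMoment_pos 1 (exp_pos u)
  have h2 := pi_mul_thetaMoment_one_le (exp_pos u)
  rw [logThetaDeriv₂]
  generalize exp u = t at *
  generalize thetaMoment 0 t = T0 at *
  generalize thetaMoment 1 t = T1 at *
  generalize thetaMoment 2 t = T2 at *
  have hpi := pi_gt_three
  have : 0 < t * T2 * T0 - T1 * T0 - t * T1 ^ 2 := by
    have a1 : 3 * T1 ≤ T2 := by nlinarith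
    have a2 : t * (3 * T1) * T0 ≤ t * T2 * T0 := by gcongr
    have a3 : T1 * T0 ≤ t * T1 * T0 := by
      have : 0 ≤ T1 * T0 := by positivity
      nlinarith
    have a4 : t * T1 ^ 2 ≤ t * T1 * T0 := by
      have : T1 ≤ T0 := by linarith
      calc t * T1 ^ 2 = t * T1 * T1 := by ring
        _ ≤ _ := by gcongr
    have a5 : 0 < t * T1 * T0 := by positivity
    nlinarith
  positivity

lemma logTheta_neg (u : ℝ) : logTheta (-u) = u / 2 + logTheta u := by
  have h := cosKernel_eq_evenKernel 0 (exp_pos (-u))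
  rw [evenKernel_eq_cosKernel_of_zero, one_div, ← Real.exp_neg, neg_neg] at h
  have hp : 0 < cosKernel 0 (exp u) := by
    have := cosKernel_pos 0 (exp_pos u); exact_mod_cast this
  rw [logTheta, h, Real.log_mul (by positivity) hp.ne', Real.log_rpow (exp_pos u), Real.log_exp,
    logTheta]
  ring

lemma logThetaDeriv_neg (u : ℝ) : logThetaDeriv (-u) = -1 / 2 - logThetaDeriv u := by
  have h1 : HasDerivAt (fun v => logTheta (-v)) (-logThetaDeriv (-u)) u := by
    have := (hasDerivAt_logTheta (-u)).comp u (hasDerivAt_neg u)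
    simpa [Function.comp_def] using this
  have h2 : HasDerivAt (fun v => logTheta (-v)) (1 / 2 + logThetaDeriv u) u := by
    have : (fun v => logTheta (-v)) = fun v => v / 2 + logTheta v := funext logTheta_neg
    rw [this]
    exact ((hasDerivAt_id u).div_const 2).add (hasDerivAt_logTheta u)
  have := h1.unique h2
  linarith

lemma monotone_logThetaDeriv : Monotone logThetaDeriv := by
  have hI : MonotoneOn logThetaDeriv (Set.Ici 0) := by
    refine monotoneOn_of_deriv_nonneg (convex_Ici 0)
      (fun u _ => (hasDerivAt_logThetaDeriv u).continuousAt.continuousWithinAt)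
      (fun u _ => (hasDerivAt_logThetaDeriv u).differentiableAt.differentiableWithinAt) ?_
    intro u hu
    rw [interior_Ici] at hu
    rw [(hasDerivAt_logThetaDeriv u).deriv]
    exact (logThetaDeriv₂_pos (le_of_lt hu)).le
  refine MonotoneOn.Iic_union_Ici (a := 0) ?_ hI
  intro x hx y hy hxy
  simp only [Set.mem_Iic] at hx hy
  have := hI (a := -y) (b := -x) (by simpa using hy) (by simpa using hx) (by linarith)
  rw [logThetaDeriv_neg, logThetaDeriv_neg] at this
  linarith

lemma convexOn_logTheta : ConvexOn ℝ Set.univ logTheta := by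
  refine Monotone.convexOn_univ_of_deriv (fun u => (hasDerivAt_logTheta u).differentiableAt) ?_
  have : deriv logTheta = logThetaDeriv := funext fun u => (hasDerivAt_logTheta u).deriv
  rw [this]
  exact monotone_logThetaDeriv

lemma ConvexOn.add_deriv_mul_le {S : Set ℝ} {f : ℝ → ℝ} {x y f' : ℝ} (hf : ConvexOn ℝ S f)
    (hx : x ∈ S) (hy : y ∈ S) (h : HasDerivAt f f' x) : f x + f' * (y - x) ≤ f y := by
  rcases lt_trichotomy x y with hxy | rfl | hxy
  · have := hf.le_slope_of_hasDerivAt hx hy hxy h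
    rw [slope_def_field, le_div_iff₀ (by linarith)] at this
    linarith
  · simp
  · have := hf.slope_le_of_hasDerivAt hy hx hxy h
    rw [slope_def_field, div_le_iff₀ (by linarith)] at this
    linarith

lemma exists_logTheta_strong_convexity : ∃ c : ℝ, 0 < c ∧ ∀ s ∈ Set.Icc (1 : ℝ) 2, ∀ u : ℝ,
    logTheta s + logThetaDeriv s * u + c * min (u ^ 2) 1 ≤ logTheta (s + u) := by
  obtain ⟨m, hm, hmin⟩ := (isCompact_Icc (a := (0 : ℝ)) (b := 3)).exists_isMinOn ⟨0, by norm_num⟩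
    continuous_logThetaDeriv₂.continuousOn
  set c := logThetaDeriv₂ m
  have hc : 0 < c := logThetaDeriv₂_pos hm.1
  have hd (v : ℝ) : HasDerivAt (fun v => logTheta v - c / 2 * v ^ 2) (logThetaDeriv v - c * v) v := by
    convert! (hasDerivAt_logTheta v).sub ((hasDerivAt_pow 2 v).const_mul (c / 2)) using 1
    norm_num; ring
  have hd2 (v : ℝ) : HasDerivAt (fun v => logThetaDeriv v - c * v) (logThetaDeriv₂ v - c) v := by
    convert! (hasDerivAt_logThetaDeriv v).sub ((hasDerivAt_id v).const_mul c) using 1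
    simp
  have hconv : ConvexOn ℝ (Set.Icc 0 3) (fun v => logTheta v - c / 2 * v ^ 2) := by
    refine convexOn_of_hasDerivWithinAt2_nonneg (convex_Icc 0 3)
      (fun v _ => (hd v).continuousAt.continuousWithinAt)
      (fun v _ => (hd v).hasDerivWithinAt) (fun v _ => (hd2 v).hasDerivWithinAt) ?_
    intro v hv
    have := hmin (interior_subset hv)
    simp only [Set.mem_ofPred_eq] at this
    linarith
  have small (s : ℝ) (hs : s ∈ Set.Icc (1 : ℝ) 2) (u : ℝ) (hu : |u| ≤ 1) :
      logTheta s + logThetaDeriv s * u + c / 2 * u ^ 2 ≤ logTheta (s + u) := by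
    rw [abs_le] at hu
    have := hconv.add_deriv_mul_le (x := s) (y := s + u) ⟨by linarith [hs.1], by linarith [hs.2]⟩
      ⟨by linarith [hs.1], by linarith [hs.2]⟩ (hd s)
    nlinarith
  refine ⟨c / 2, half_pos hc, fun s hs u => ?_⟩
  rcases le_total |u| 1 with hu | hu
  · have h1 : min (u ^ 2) 1 ≤ u ^ 2 := min_le_left _ _
    have := small s hs u hu
    nlinarith
  · have hu0 : 0 < |u| := by linarith
    set e := u / |u| with he
    have hue : u = |u| * e := by rw [he]; field_simp
    have he1 : |e| = 1 := by rw [he, abs_div, abs_abs]; field_simp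
    have h1 := small s hs e he1.le
    rw [← sq_abs, he1] at h1
    have h2 := convexOn_logTheta.2 (Set.mem_univ s) (Set.mem_univ (s + u))
      (show 0 ≤ 1 - 1 / |u| by rw [sub_nonneg, div_le_one hu0]; exact hu)
      (show 0 ≤ 1 / |u| by positivity) (by ring)
    simp only [smul_eq_mul] at h2
    rw [show (1 - 1 / |u|) * s + 1 / |u| * (s + u) = s + e by rw [he]; ring] at h2
    have h3 : |u| * logTheta (s + e) ≤ (|u| - 1) * logTheta s + logTheta (s + u) := by
      have := mul_le_mul_of_nonneg_left h2 hu0.le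
      have e3 : |u| * ((1 - 1 / |u|) * logTheta s + 1 / |u| * logTheta (s + u))
        = (|u| - 1) * logTheta s + logTheta (s + u) := by field_simp
      linarith
    have h4 : min (u ^ 2) 1 ≤ 1 := min_le_right _ _
    have h5 := mul_le_mul_of_nonneg_left h1 hu0.le
    have h6 : logThetaDeriv s * u = |u| * (logThetaDeriv s * e) := by
      conv_lhs => rw [hue]
      ring
    rw [h6]
    nlinarith

lemma hasSum_pi_prod {d : ℕ} (f : Fin d → ℤ → ℂ) (hf : ∀ i, Summable fun k => ‖f i k‖) :
    Summable (fun n : Fin d → ℤ => ‖∏ i, f i (n i)‖) ∧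
      HasSum (fun n : Fin d → ℤ => ∏ i, f i (n i)) (∏ i, ∑' k, f i k) := by
  induction d with
  | zero => 
    refine ⟨Summable.of_finite, ?_⟩
    simp only [Finset.univ_eq_empty, Finset.prod_empty]
    convert hasSum_unique (fun _ : Fin 0 → ℤ => (1 : ℂ))
  | succ d ih =>
    obtain ⟨h1, h2⟩ := ih (fun i => f i.succ) (fun i => hf i.succ)
    have h3 := (hf 0).mul_norm h1
    have h4 := summable_mul_of_summable_norm (hf 0) h1
    have h5 := tsum_mul_tsum_of_summable_norm (hf 0) h1
    have e : (fun n : Fin (d + 1) → ℤ => ∏ i, f i (n i)) ∘ (Fin.consEquiv fun _ => ℤ) =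
        fun z : ℤ × (Fin d → ℤ) => f 0 z.1 * ∏ i, f i.succ (z.2 i) := by
      funext z
      simp [Fin.consEquiv, Fin.prod_univ_succ]
    constructor
    · rw [← (Fin.consEquiv fun _ => ℤ).summable_iff]
      have : (fun n : Fin (d + 1) → ℤ => ‖∏ i, f i (n i)‖) ∘ (Fin.consEquiv fun _ => ℤ) =
        fun z : ℤ × (Fin d → ℤ) => ‖f 0 z.1 * ∏ i, f i.succ (z.2 i)‖ := by
        funext z
        have := congrFun e z
        simp only [Function.comp] at this ⊢
        rw [this]
      rw [this]; exact h3
    · rw [← (Fin.consEquiv fun _ => ℤ).hasSum_iff, e, Fin.prod_univ_succ, ← h2.tsum_eq, h5]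
      exact h4.hasSum

/-- The theta function of the orthorhombic lattice with character `x`, as a product. -/
def thetaProd {d : ℕ} (a x : Fin d → ℝ) (t : ℝ) : ℝ :=
  ∏ i, cosKernel (x i : UnitAddCircle) (a i ^ 2 * t)

lemma hasSum_thetaProd {d : ℕ} {a : Fin d → ℝ} (ha : ∀ i, 0 < a i) (x : Fin d → ℝ) {t : ℝ}
    (ht : 0 < t) :
    HasSum (fun n : Fin d → ℤ => cos (2 * π * ∑ i, x i * n i) * exp (-π * Qf d a n * t))
      (thetaProd a x t) := by
  have hat (i) : 0 < a i ^ 2 * t := by have := ha i; positivity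
  have h := (hasSum_pi_prod (fun (i : Fin d) (k : ℤ) =>
    Complex.exp (2 * π * Complex.I * x i * k) * (exp (-π * k ^ 2 * (a i ^ 2 * t)) : ℝ)) ?_).2
  · simp only [fun i => (hasSum_int_cosKernel (x i) (hat i)).tsum_eq] at h
    rw [← Complex.ofReal_prod] at h
    have h2 := Complex.hasSum_re h
    rw [Complex.ofReal_re] at h2
    convert! h2 using 1
    funext n
    rw [Finset.prod_mul_distrib, ← Complex.ofReal_prod, Complex.re_mul_ofReal, ← Complex.exp_sum,
      ← Real.exp_sum]
    congr 1
    · rw [← Complex.exp_ofReal_mul_I_re]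
      congr 2
      push_cast
      rw [Finset.mul_sum, Finset.sum_mul]
      exact Finset.sum_congr rfl fun i _ => by ring
    · congr 1
      rw [Qf, Finset.mul_sum, Finset.sum_mul]
      exact Finset.sum_congr rfl fun i _ => by ring
  · intro i
    exact (hasSum_int_cosKernel (x i) (hat i)).summable.norm

lemma hasSum_thetaProd_sub_one {d : ℕ} {a : Fin d → ℝ} (ha : ∀ i, 0 < a i) (x : Fin d → ℝ) {t : ℝ}
    (ht : 0 < t) :
    HasSum (fun n : {n : Fin d → ℤ // n ≠ 0} =>
      cos (2 * π * ∑ i, x i * n.1 i) * exp (-π * Qf d a n.1 * t)) (thetaProd a x t - 1) := by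
  have h := hasSum_ite_sub_hasSum (hasSum_thetaProd ha x ht) 0
  have h2 := (hasSum_subtype_iff_indicator (s := {n : Fin d → ℤ | n ≠ 0})
    (f := fun n : Fin d → ℤ => cos (2 * π * ∑ i, x i * n i) * exp (-π * Qf d a n * t))
    (a := thetaProd a x t - 1)).2 ?_
  · exact h2
  · convert! h using 1
    · funext n
      by_cases hn : n = 0 <;> simp [hn]
    · simp [Qf]

lemma Qf_pos {d : ℕ} {a : Fin d → ℝ} (ha : ∀ i, 0 < a i) {n : Fin d → ℤ} (hn : n ≠ 0) :
    0 < Qf d a n := by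
  obtain ⟨i, hi⟩ := Function.ne_iff.1 hn
  refine Finset.sum_pos' (fun i _ => by positivity) ⟨i, Finset.mem_univ i, ?_⟩
  have := ha i
  have h2 : (n i : ℝ) ≠ 0 := by exact_mod_cast hi
  positivity

lemma summable_Qf_rpow {d : ℕ} {a : Fin d → ℝ} (ha : ∀ i, 0 < a i) {s : ℝ} (hs : (d : ℝ) / 2 < s) :
    Summable fun n : {n : Fin d → ℤ // n ≠ 0} => Qf d a n.1 ^ (-s) := by
  have hs0 : 0 < s := lt_of_le_of_lt (by positivity) hs
  let L := Submodule.span ℤ (Set.range (Pi.basisFun ℝ (Fin d)))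
  have hL : Module.finrank ℤ L = d := by
    rw [ZLattice.rank ℝ L]; simp
  have h1 := ZLattice.summable_norm_rpow L (-(2 * s)) (by rw [hL]; linarith)
  let e : {n : Fin d → ℤ // n ≠ 0} → L := fun n => ⟨fun i => (n.1 i : ℝ), by
    rw [Module.Basis.mem_span_iff_repr_mem]
    intro i
    exact ⟨n.1 i, by simp⟩⟩
  have he : Function.Injective e := by
    intro m n h
    apply Subtype.ext
    funext i
    have : (m.1 i : ℝ) = (n.1 i : ℝ) := congrFun (congrArg Subtype.val h) i
    exact_mod_cast this
  have h2 := h1.comp_injective he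
  obtain ⟨μ, hμ, hμa⟩ : ∃ μ : ℝ, 0 < μ ∧ ∀ i, μ ≤ a i ^ 2 := by
    rcases isEmpty_or_nonempty (Fin d) with h | h
    · exact ⟨1, one_pos, fun i => h.elim i⟩
    · obtain ⟨i, hi⟩ := Finite.exists_min (fun i => a i ^ 2)
      exact ⟨a i ^ 2, pow_pos (ha i) 2, hi⟩
  refine Summable.of_nonneg_of_le (fun n => rpow_nonneg (Qf_pos ha n.2).le _) (fun n => ?_)
    (h2.mul_left (μ ^ (-s)))
  have hne : 0 < ‖(e n : Fin d → ℝ)‖ := by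
    rw [norm_pos_iff]
    intro h
    apply n.2
    funext i
    have := congrFun h i
    simpa [e] using this
  have hle : μ * ‖(e n : Fin d → ℝ)‖ ^ 2 ≤ Qf d a n.1 := by
    have : ‖(e n : Fin d → ℝ)‖ ≤ √(∑ i, (n.1 i : ℝ) ^ 2) := by
      rw [pi_norm_le_iff_of_nonneg (sqrt_nonneg _)]
      intro i
      exact Real.abs_le_sqrt (Finset.single_le_sum (f := fun i => (n.1 i : ℝ) ^ 2)
        (fun i _ => sq_nonneg _) (Finset.mem_univ i))
    calc μ * ‖(e n : Fin d → ℝ)‖ ^ 2 ≤ μ * √(∑ i, (n.1 i : ℝ) ^ 2) ^ 2 := by gcongr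
      _ = ∑ i, μ * (n.1 i : ℝ) ^ 2 := by
        rw [Real.sq_sqrt (Finset.sum_nonneg fun i _ => sq_nonneg _), Finset.mul_sum]
      _ ≤ _ := Finset.sum_le_sum fun i _ => by gcongr; exact hμa i
  calc Qf d a n.1 ^ (-s) ≤ (μ * ‖(e n : Fin d → ℝ)‖ ^ 2) ^ (-s) :=
        Real.rpow_le_rpow_of_nonpos (by positivity) hle (by linarith)
    _ = μ ^ (-s) * ‖(e n : Fin d → ℝ)‖ ^ (-(2 * s)) := by
        rw [Real.mul_rpow hμ.le (by positivity), ← Real.rpow_natCast, ← Real.rpow_mul hne.le]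
        congr 2; push_cast; ring

lemma hasSum_mellin_real {ι : Type*} [Countable ι] {c Q : ι → ℝ} {F : ℝ → ℝ} {s : ℝ}
    (hQ : ∀ i, 0 < Q i) (hs : 0 < s)
    (hF : ∀ t, 0 < t → HasSum (fun i => c i * exp (-π * Q i * t)) (F t))
    (hsum : Summable fun i => |c i| * Q i ^ (-s)) :
    HasSum (fun i => Gamma s * π ^ (-s) * (c i * Q i ^ (-s)))
      (∫ t in Set.Ioi (0 : ℝ), F t * t ^ (s - 1)) := by
  have hint (i : ι) : ∫ t in Set.Ioi (0 : ℝ), t ^ (s - 1) * exp (-(π * Q i * t))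
      = Gamma s * π ^ (-s) * Q i ^ (-s) := by
    have := hQ i
    rw [Real.integral_rpow_mul_exp_neg_mul_Ioi hs (by positivity), one_div, Real.inv_rpow (by positivity),
      ← Real.rpow_neg (by positivity), Real.mul_rpow pi_pos.le this.le]
    ring
  have hint' (i : ι) : Integrable (fun t : ℝ => t ^ (s - 1) * exp (-(π * Q i * t)))
      (volume.restrict (Set.Ioi 0)) := by
    apply MeasureTheory.Integrable.of_integral_ne_zero
    rw [hint]
    have := hQ i
    have := Real.Gamma_pos_of_pos hs
    positivity
  have H := hasSum_integral_of_summable_integral_norm (μ := volume.restrict (Set.Ioi (0 : ℝ)))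
    (F := fun i t => c i * (t ^ (s - 1) * exp (-(π * Q i * t))))
    (fun i => (hint' i).const_mul (c i)) ?_
  · convert! H using 1
    · funext i
      rw [integral_const_mul, hint]; ring
    · refine setIntegral_congr_fun measurableSet_Ioi fun t ht => ?_
      have := (hF t ht).mul_right (t ^ (s - 1))
      rw [← this.tsum_eq]
      refine tsum_congr fun i => ?_
      rw [show -π * Q i * t = -(π * Q i * t) by ring]; ring
  · have : ∀ i, ∫ t in Set.Ioi (0 : ℝ), ‖c i * (t ^ (s - 1) * exp (-(π * Q i * t)))‖
        = Gamma s * π ^ (-s) * (|c i| * Q i ^ (-s)) := by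
      intro i
      rw [setIntegral_congr_fun (g := fun t => |c i| * (t ^ (s - 1) * exp (-(π * Q i * t)))) measurableSet_Ioi,
        integral_const_mul, hint]
      · ring
      · intro t ht
        have ht' : (0 : ℝ) < t := ht
        simp only [norm_mul, Real.norm_eq_abs, Real.abs_exp]
        rw [abs_of_pos (Real.rpow_pos_of_pos ht' _)]
    simp only [this]
    exact hsum.mul_left _

/-- The Epstein zeta function of the orthorhombic lattice with character `x`. -/
def epstein {d : ℕ} (a x : Fin d → ℝ) (s : ℝ) : ℝ :=
  ∑' n : {n : Fin d → ℤ // n ≠ 0}, cos (2 * π * ∑ i, x i * n.1 i) * Qf d a n.1 ^ (-s)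

section
variable {d : ℕ} {a : Fin d → ℝ} {s : ℝ}

lemma summable_abs_epstein (ha : ∀ i, 0 < a i) (hs : (d : ℝ) / 2 < s) (x : Fin d → ℝ) :
    Summable fun n : {n : Fin d → ℤ // n ≠ 0} =>
      |cos (2 * π * ∑ i, x i * n.1 i)| * Qf d a n.1 ^ (-s) :=
  Summable.of_nonneg_of_le (fun n => mul_nonneg (abs_nonneg _) (rpow_nonneg (Qf_pos ha n.2).le _))
    (fun n => mul_le_of_le_one_left (rpow_nonneg (Qf_pos ha n.2).le _) (abs_cos_le_one _))
    (summable_Qf_rpow ha hs)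

lemma summable_epstein (ha : ∀ i, 0 < a i) (hs : (d : ℝ) / 2 < s) (x : Fin d → ℝ) :
    Summable fun n : {n : Fin d → ℤ // n ≠ 0} =>
      cos (2 * π * ∑ i, x i * n.1 i) * Qf d a n.1 ^ (-s) := by
  refine Summable.of_norm ((summable_abs_epstein ha hs x).congr fun n => ?_)
  rw [norm_mul, Real.norm_eq_abs, Real.norm_of_nonneg (rpow_nonneg (Qf_pos ha n.2).le _)]

lemma epstein_mellin (ha : ∀ i, 0 < a i) (hs : (d : ℝ) / 2 < s) (x : Fin d → ℝ) :
    ∫ t in Set.Ioi (0 : ℝ), (thetaProd a x t - 1) * t ^ (s - 1) =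
      Gamma s * π ^ (-s) * epstein a x s := by
  have hs0 : 0 < s := lt_of_le_of_lt (by positivity) hs
  rw [epstein, ← tsum_mul_left]
  exact (hasSum_mellin_real (fun n : {n : Fin d → ℤ // n ≠ 0} => Qf_pos ha n.2) hs0
    (fun t ht => hasSum_thetaProd_sub_one ha x ht) (summable_abs_epstein ha hs x)).tsum_eq.symm

lemma Gamma_mul_pi_rpow_pos (hs : (d : ℝ) / 2 < s) : 0 < Gamma s * π ^ (-s) := by
  have hs0 : 0 < s := lt_of_le_of_lt (by positivity) hs
  have := Real.Gamma_pos_of_pos hs0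
  positivity

lemma epstein_zero_pos (hd : 1 ≤ d) (ha : ∀ i, 0 < a i) (hs : (d : ℝ) / 2 < s) :
    0 < epstein a (fun _ => 0) s := by
  have h := summable_epstein ha hs (fun _ => 0)
  have hn : (Pi.single ⟨0, hd⟩ 1 : Fin d → ℤ) ≠ 0 := by simp
  refine h.tsum_pos (fun n => ?_) ⟨_, hn⟩ ?_
  · simpa using rpow_nonneg (Qf_pos ha n.2).le _
  · simpa using rpow_pos_of_pos (Qf_pos ha hn) _

lemma continuousOn_thetaProd (ha : ∀ i, 0 < a i) (x : Fin d → ℝ) :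
    ContinuousOn (thetaProd a x) (Set.Ioi 0) := by
  refine continuousOn_finsetProd _ fun i _ => ?_
  refine (continuousOn_cosKernel _).comp (by fun_prop) fun t ht => ?_
  exact mul_pos (pow_pos (ha i) 2) ht

lemma abs_thetaProd_sub_one_le (ha : ∀ i, 0 < a i) (x : Fin d → ℝ) {t : ℝ} (ht : 0 < t) :
    |thetaProd a x t - 1| ≤ thetaProd a (fun _ => 0) t - 1 := by
  have h0 := hasSum_thetaProd_sub_one ha (fun _ => 0) ht
  have hx := hasSum_thetaProd_sub_one ha x ht
  simp only [zero_mul, Finset.sum_const_zero, mul_zero, cos_zero, one_mul] at h0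
  rw [abs_le]
  constructor
  · refine hasSum_le (fun n => ?_) h0.neg hx
    nlinarith [exp_pos (-π * Qf d a n.1 * t), neg_one_le_cos (2 * π * ∑ i, x i * n.1 i)]
  · refine hasSum_le (fun n => ?_) hx h0
    nlinarith [exp_pos (-π * Qf d a n.1 * t), cos_le_one (2 * π * ∑ i, x i * n.1 i)]

lemma integrableOn_thetaProd (hd : 1 ≤ d) (ha : ∀ i, 0 < a i) (hs : (d : ℝ) / 2 < s)
    (x : Fin d → ℝ) :
    IntegrableOn (fun t => (thetaProd a x t - 1) * t ^ (s - 1)) (Set.Ioi 0) := by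
  have h0 : IntegrableOn (fun t => (thetaProd a (fun _ => 0) t - 1) * t ^ (s - 1)) (Set.Ioi 0) := by
    apply MeasureTheory.Integrable.of_integral_ne_zero
    rw [epstein_mellin ha hs]
    exact (mul_pos (Gamma_mul_pi_rpow_pos hs) (epstein_zero_pos hd ha hs)).ne'
  refine Integrable.mono' h0 ?_ ?_
  · refine ContinuousOn.aestronglyMeasurable ?_ measurableSet_Ioi
    refine ((continuousOn_thetaProd ha x).sub continuousOn_const).mul ?_
    exact fun t ht => (Real.continuousAt_rpow_const t _ (Or.inl (ne_of_gt ht))).continuousWithinAt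
  · filter_upwards [ae_restrict_mem measurableSet_Ioi] with t ht
    have ht' : 0 < t ^ (s - 1) := rpow_pos_of_pos ht _
    rw [norm_mul, Real.norm_of_nonneg ht'.le]
    exact mul_le_mul_of_nonneg_right (abs_thetaProd_sub_one_le ha x ht) ht'.le

lemma thetaProd_half_le (ha : ∀ i, 0 < a i) (x : Fin d → ℝ) {t : ℝ} (ht : 0 < t) :
    thetaProd a (fun _ => 1 / 2) t ≤ thetaProd a x t :=
  Finset.prod_le_prod (fun i _ => (cosKernel_pos _ (mul_pos (pow_pos (ha i) 2) ht)).le)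
    fun i _ => cosKernel_half_le _ (mul_pos (pow_pos (ha i) 2) ht)

lemma epstein_sub_mellin (hd : 1 ≤ d) (ha : ∀ i, 0 < a i) (hs : (d : ℝ) / 2 < s) {b : Fin d → ℝ}
    (hb : ∀ i, 0 < b i) (x y : Fin d → ℝ) :
    ∫ t in Set.Ioi (0 : ℝ), (thetaProd a x t - thetaProd b y t) * t ^ (s - 1) =
      Gamma s * π ^ (-s) * (epstein a x s - epstein b y s) := by
  rw [mul_sub, ← epstein_mellin ha hs, ← epstein_mellin hb hs,
    ← integral_sub (integrableOn_thetaProd hd ha hs x) (integrableOn_thetaProd hd hb hs y)]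
  congr 1
  funext t
  ring

lemma integrableOn_thetaProd_sub (hd : 1 ≤ d) (ha : ∀ i, 0 < a i) (hs : (d : ℝ) / 2 < s)
    {b : Fin d → ℝ} (hb : ∀ i, 0 < b i) (x y : Fin d → ℝ) :
    IntegrableOn (fun t => (thetaProd a x t - thetaProd b y t) * t ^ (s - 1)) (Set.Ioi 0) := by
  convert! (integrableOn_thetaProd hd ha hs x).sub (integrableOn_thetaProd hd hb hs y) using 1
  funext t
  simp only [Pi.sub_apply]
  ring

lemma epstein_half_le (hd : 1 ≤ d) (ha : ∀ i, 0 < a i) (hs : (d : ℝ) / 2 < s) (x : Fin d → ℝ) :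
    epstein a (fun _ => 1 / 2) s ≤ epstein a x s := by
  have h := epstein_sub_mellin hd ha hs ha x (fun _ => 1 / 2)
  have : 0 ≤ ∫ t in Set.Ioi (0 : ℝ), (thetaProd a x t - thetaProd a (fun _ => 1 / 2) t) * t ^ (s - 1) :=
    setIntegral_nonneg measurableSet_Ioi fun t ht =>
      mul_nonneg (sub_nonneg.2 (thetaProd_half_le ha x ht)) (rpow_pos_of_pos ht _).le
  rw [h] at this
  exact sub_nonneg.1 (nonneg_of_mul_nonneg_right this (Gamma_mul_pi_rpow_pos hs))

end

section
variable {d : ℕ} {a : Fin d → ℝ} {s : ℝ}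

lemma cos_eq_neg_one_of_epstein_eq (hd : 1 ≤ d) (ha : ∀ i, 0 < a i) (hs : (d : ℝ) / 2 < s)
    {x : Fin d → ℝ} (hx : epstein a x s = epstein a (fun _ => 1 / 2) s) (i : Fin d) :
    cos (2 * π * x i) = -1 := by
  by_contra hne
  have hci : 0 < 1 + cos (2 * π * x i) :=
    lt_of_le_of_ne (by linarith [neg_one_le_cos (2 * π * x i)]) fun h => hne (by linarith)
  have h := epstein_sub_mellin hd ha hs ha x (fun _ => 1 / 2)
  rw [hx, sub_self, mul_zero] at h
  rw [setIntegral_eq_zero_iff_of_nonneg_ae ?_ (integrableOn_thetaProd_sub hd ha hs ha x _)] at h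
  swap
  · filter_upwards [ae_restrict_mem measurableSet_Ioi] with t ht
    exact mul_nonneg (sub_nonneg.2 (thetaProd_half_le ha x ht)) (rpow_pos_of_pos ht _).le
  obtain ⟨T, hT0, hT⟩ : ∃ T : ℝ, 0 < T ∧ ∀ j, 1 / 2 ≤ a j ^ 2 * T := by
    obtain ⟨j, hj⟩ := @Finite.exists_min _ _ _ ⟨(⟨0, hd⟩ : Fin d)⟩ _ (fun i => a i ^ 2)
    have := pow_pos (ha j) 2
    refine ⟨(a j ^ 2)⁻¹, by positivity, fun k => ?_⟩
    have h1 := hj k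
    calc (1 / 2 : ℝ) ≤ a j ^ 2 * (a j ^ 2)⁻¹ := by rw [mul_inv_cancel₀ this.ne']; norm_num
      _ ≤ _ := by gcongr
  have hpos : ∀ t ∈ Set.Ioi T, 0 < (thetaProd a x t - thetaProd a (fun _ => 1 / 2) t) * t ^ (s - 1) := by
    intro t ht
    have ht0 : 0 < t := hT0.trans ht
    refine mul_pos (sub_pos.2 ?_) (rpow_pos_of_pos ht0 _)
    refine Finset.prod_lt_prod (fun i _ => cosKernel_pos _ (mul_pos (pow_pos (ha i) 2) ht0))
      (fun i _ => cosKernel_half_le _ (mul_pos (pow_pos (ha i) 2) ht0)) ⟨i, Finset.mem_univ i, ?_⟩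
    have h1 : 1 / 2 ≤ a i ^ 2 * t := (hT i).trans (by gcongr; exact le_of_lt ht)
    have h2 := cosKernel_half_gap (x := x i) h1
    have h3 := mul_pos hci (exp_pos (-π * (a i ^ 2 * t)))
    linarith
  have h4 := ae_restrict_of_ae_restrict_of_subset (Set.Ioi_subset_Ioi hT0.le) h
  have h5 : ∀ᵐ t ∂(volume.restrict (Set.Ioi T)), False := by
    filter_upwards [h4, ae_restrict_mem measurableSet_Ioi] with t h6 h7
    exact (hpos t h7).ne' h6
  rw [Filter.eventually_false_iff_eq_bot, ae_eq_bot, Measure.restrict_eq_zero] at h5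
  simp at h5

end

lemma sum_normSq_mul_addChar {G : Type*} [AddCommGroup G] [Fintype G] (f : G → ℝ) (n : G) :
    ∑ ψ : AddChar G ℂ, ‖∑ m, (f m : ℂ) * ψ m‖ ^ 2 * (ψ n).re =
      Fintype.card G * ∑ m, f m * f (m + n) := by
  classical
  have h : ∑ ψ : AddChar G ℂ, ((‖∑ m, (f m : ℂ) * ψ m‖ ^ 2 : ℝ) : ℂ) * ψ n =
      ((Fintype.card G * ∑ m, f m * f (m + n) : ℝ) : ℂ) := by
    have h1 (ψ : AddChar G ℂ) : ((‖∑ m, (f m : ℂ) * ψ m‖ ^ 2 : ℝ) : ℂ) * ψ n =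
        ∑ m, ∑ k, (f m : ℂ) * f k * ψ (m + n - k) := by
      rw [Complex.ofReal_pow, ← Complex.mul_conj', map_sum, Finset.sum_mul_sum, Finset.sum_mul]
      refine Finset.sum_congr rfl fun m _ => ?_
      rw [Finset.sum_mul]
      refine Finset.sum_congr rfl fun k _ => ?_
      rw [map_mul, Complex.conj_ofReal, ← AddChar.map_neg_eq_conj, sub_eq_add_neg,
        AddChar.map_add_eq_mul, AddChar.map_add_eq_mul]
      ring
    simp only [h1]
    rw [Finset.sum_comm]
    push_cast
    rw [Finset.mul_sum]
    refine Finset.sum_congr rfl fun m _ => ?_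
    rw [Finset.sum_comm, Finset.sum_eq_single (m + n)]
    · rw [← Finset.mul_sum, AddChar.sum_apply_eq_ite, if_pos (sub_self _)]
      ring
    · intro k _ hk
      rw [← Finset.mul_sum, AddChar.sum_apply_eq_ite, if_neg, mul_zero]
      exact fun h => hk (sub_eq_zero.1 h).symm
    · simp
  have h2 := congrArg Complex.re h
  rw [Complex.ofReal_re, Complex.re_sum] at h2
  simpa only [Complex.re_ofReal_mul] using h2

lemma periodic_add_smul {d N : ℕ} {φ : (Fin d → ℤ) → ℝ}
    (h : ∀ n : Fin d → ℤ, ∀ i : Fin d, φ (n + Pi.single i (N : ℤ)) = φ n) (n k : Fin d → ℤ) :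
    φ (n + (N : ℤ) • k) = φ n := by
  let H : AddSubgroup (Fin d → ℤ) :=
    { carrier := {v | ∀ n, φ (n + v) = φ n}
      add_mem' := fun {u v} hu hv n => by rw [← add_assoc, hv, hu]
      zero_mem' := fun n => by rw [add_zero]
      neg_mem' := fun {v} hv n => by
        have := hv (n + -v)
        rwa [neg_add_cancel_right, eq_comm] at this }
  have hk : (N : ℤ) • k = ∑ i, k i • Pi.single i (N : ℤ) := by
    funext j
    simp [Finset.sum_apply, Pi.single_apply, mul_comm]
  have : (N : ℤ) • k ∈ H := by
    rw [hk]
    exact sum_mem fun i _ => H.zsmul_mem (fun n => h n i) _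
  exact this n

lemma AddChar.map_finset_sum {ι A M : Type*} [AddCommMonoid A] [CommMonoid M] (ψ : AddChar A M)
    (s : Finset ι) (f : ι → A) : ψ (∑ i ∈ s, f i) = ∏ i ∈ s, ψ (f i) := by
  classical
  induction s using Finset.induction_on with
  | empty => simp
  | insert i s hi ih => rw [Finset.sum_insert hi, Finset.prod_insert hi, AddChar.map_add_eq_mul, ih]

lemma addChar_intCast {d N : ℕ} (hN : N ≠ 0) (ψ : AddChar (Fin d → ZMod N) ℂ) :
    ∃ x : Fin d → ℝ, ∀ n : Fin d → ℤ,
      (ψ fun i => (n i : ZMod N)).re = cos (2 * π * ∑ i, x i * n i) := by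
  have : NeZero N := ⟨hN⟩
  refine ⟨fun i => (ψ (Pi.single i 1)).arg / (2 * π), fun n => ?_⟩
  have hn : (fun i => (n i : ZMod N)) = ∑ i, n i • (Pi.single i 1 : Fin d → ZMod N) := by
    funext j
    simp [Finset.sum_apply, Pi.single_apply]
  have hs (z : Fin d → ZMod N) : ψ z = Complex.exp ((ψ z).arg * Complex.I) := by
    conv_lhs => rw [← Complex.norm_mul_exp_arg_mul_I (ψ z), AddChar.norm_apply]
    simp
  have h : (ψ fun i => (n i : ZMod N)) =
      Complex.exp (((2 * π * ∑ i, (ψ (Pi.single i 1)).arg / (2 * π) * n i : ℝ) : ℂ) * Complex.I) := by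
    rw [hn, AddChar.map_finset_sum, Finset.mul_sum, Complex.ofReal_sum, Finset.sum_mul,
      Complex.exp_sum]
    refine Finset.prod_congr rfl fun i _ => ?_
    rw [AddChar.map_zsmul_eq_zpow, hs (Pi.single i 1), ← Complex.exp_int_mul, ← hs]
    congr 1
    push_cast
    have : (π : ℂ) ≠ 0 := by exact_mod_cast pi_ne_zero
    field_simp
  rw [h, Complex.exp_ofReal_mul_I_re]

lemma exists_zmod_lift {d N : ℕ} {φ : (Fin d → ℤ) → ℝ}
    (hφ : ∀ n : Fin d → ℤ, ∀ i : Fin d, φ (n + Pi.single i (N : ℤ)) = φ n) (hN : N ≠ 0) :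
    ∃ f : (Fin d → ZMod N) → ℝ, ∀ n : Fin d → ℤ, f (fun i => (n i : ZMod N)) = φ n := by
  have : NeZero N := ⟨hN⟩
  refine ⟨fun g => φ fun i => ((g i).val : ℤ), fun n => ?_⟩
  have h1 := periodic_add_smul hφ (fun i => (((n i : ZMod N)).val : ℤ)) (fun i => n i / N)
  refine h1.symm.trans (congrArg φ ?_)
  funext i
  simp only [Pi.add_apply, Pi.smul_apply, smul_eq_mul, ZMod.val_intCast]
  exact Int.emod_add_mul_ediv _ _

lemma sum_fin_eq_sum_zmod {d N : ℕ} [NeZero N] (F : (Fin d → ZMod N) → ℝ) :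
    ∑ m : Fin d → Fin N, F (fun i => ((m i : ℤ) : ZMod N)) = ∑ g, F g := by
  refine Fintype.sum_equiv (Equiv.piCongrRight fun _ => (ZMod.finEquiv N).toEquiv) _ _ fun m => ?_
  congr 1
  funext i
  cases N with
  | zero => exact absurd rfl (NeZero.ne 0)
  | succ k =>
    simp only [Int.cast_natCast]
    exact Fin.cast_val_eq_self (m i)

lemma sum_fin_add {d N : ℕ} (hN : N ≠ 0) {φ : (Fin d → ℤ) → ℝ}
    (hφ : ∀ n : Fin d → ℤ, ∀ i : Fin d, φ (n + Pi.single i (N : ℤ)) = φ n) (n : Fin d → ℤ) :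
    ∑ m : Fin d → Fin N, φ ((fun i => (m i : ℤ)) + n) =
      ∑ m : Fin d → Fin N, φ (fun i => (m i : ℤ)) := by
  have : NeZero N := ⟨hN⟩
  obtain ⟨f, hf⟩ := exists_zmod_lift hφ hN
  simp only [← hf]
  rw [sum_fin_eq_sum_zmod f, ← Equiv.sum_comp (Equiv.addRight fun i => (n i : ZMod N)) f,
    ← sum_fin_eq_sum_zmod]
  refine Finset.sum_congr rfl fun m _ => congrArg f ?_
  funext i
  simp

lemma exists_charge_weights {d N : ℕ} (hN : 1 ≤ N) {φ : (Fin d → ℤ) → ℝ}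
    (hφ : ∀ n : Fin d → ℤ, ∀ i : Fin d, φ (n + Pi.single i (N : ℤ)) = φ n)
    (hnorm : ∑ m : Fin d → Fin N, (φ (fun i => (m i : ℤ))) ^ 2 = (N : ℝ) ^ d) :
    ∃ (ι : Type) (_ : Fintype ι) (w : ι → ℝ) (x : ι → Fin d → ℝ), (∀ k, 0 ≤ w k) ∧ ∑ k, w k = 1 ∧
      ∀ n : Fin d → ℤ, ((N : ℝ) ^ d)⁻¹ * ∑ m : Fin d → Fin N,
        φ (fun i => (m i : ℤ)) * φ ((fun i => (m i : ℤ)) + n) =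
          ∑ k, w k * cos (2 * π * ∑ i, x k i * n i) := by
  have hN0 : N ≠ 0 := by omega
  have : NeZero N := ⟨hN0⟩
  choose x hx using addChar_intCast (d := d) hN0
  obtain ⟨f, hf⟩ := exists_zmod_lift hφ hN0
  have hcard : (Fintype.card (Fin d → ZMod N) : ℝ) = (N : ℝ) ^ d := by simp [ZMod.card]
  have hNd : (N : ℝ) ^ d ≠ 0 := by positivity
  have key (n : Fin d → ℤ) : ((N : ℝ) ^ d)⁻¹ * ∑ m : Fin d → Fin N,
      φ (fun i => (m i : ℤ)) * φ ((fun i => (m i : ℤ)) + n) =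
        ∑ ψ : AddChar (Fin d → ZMod N) ℂ, ((N : ℝ) ^ d)⁻¹ ^ 2 * ‖∑ m, (f m : ℂ) * ψ m‖ ^ 2 *
          cos (2 * π * ∑ i, x ψ i * n i) := by
    have h := sum_normSq_mul_addChar f (fun i => (n i : ZMod N))
    rw [hcard, ← sum_fin_eq_sum_zmod] at h
    simp only [← hx, mul_assoc (((N : ℝ) ^ d)⁻¹ ^ 2)]
    rw [← Finset.mul_sum, h, sq]
    have : ∀ m : Fin d → Fin N, f ((fun i => ((m i : ℤ) : ZMod N)) + fun i => (n i : ZMod N)) =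
        φ ((fun i => (m i : ℤ)) + n) := by
      intro m
      rw [← hf]
      congr 1
      funext i
      simp
    simp only [this, hf]
    field_simp
  refine ⟨AddChar (Fin d → ZMod N) ℂ, inferInstance,
    fun ψ => ((N : ℝ) ^ d)⁻¹ ^ 2 * ‖∑ m, (f m : ℂ) * ψ m‖ ^ 2, x, fun ψ => by positivity, ?_, key⟩
  have h0 := key 0
  simp only [add_zero, ← sq, hnorm] at h0
  simpa [hNd] using h0.symm

/-- The energy of a charge distribution with Riesz interaction of exponent `2q`. -/
def chargeEnergy {d : ℕ} (a : Fin d → ℝ) (N : ℕ) (φ : (Fin d → ℤ) → ℝ) (q : ℝ) : ℝ :=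
  ∑' n : {n : Fin d → ℤ // n ≠ 0}, (((N : ℝ) ^ d)⁻¹ * ∑ m : Fin d → Fin N,
    φ (fun i => (m i : ℤ)) * φ ((fun i => (m i : ℤ)) + n.1)) * Qf d a n.1 ^ (-q)

lemma Energy_eq {d : ℕ} {p q V : ℝ} (hV : 0 < V) {a : Fin d → ℝ} (N : ℕ) (φ : (Fin d → ℤ) → ℝ) :
    Energy d p q V a N φ = (V ^ ((2 : ℝ) / d)) ^ (-p) * epstein a (fun _ => 0) p +
      (V ^ ((2 : ℝ) / d)) ^ (-q) * chargeEnergy a N φ q := by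
  have hv := rpow_pos_of_pos hV ((2 : ℝ) / d)
  have hQ (n : Fin d → ℤ) : 0 ≤ Qf d a n := Finset.sum_nonneg fun i _ => by positivity
  rw [Energy, epstein, chargeEnergy, ← tsum_mul_left, ← tsum_mul_left, ← tsum_mul_left]
  congr 1
  · refine tsum_congr fun n => ?_
    rw [mul_rpow hv.le (hQ _)]
    simp
  · refine tsum_congr fun n => ?_
    rw [← Finset.sum_mul, mul_rpow hv.le (hQ _)]
    ring

lemma altSign_eq_cos {d : ℕ} (n : Fin d → ℤ) :
    altSign d n = cos (2 * π * ∑ i, (1 / 2 : ℝ) * n i) := by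
  rw [altSign, ← Real.cos_int_mul_pi, ← Finset.mul_sum]
  congr 1
  push_cast
  ring

lemma altSign_add {d : ℕ} (m n : Fin d → ℤ) : altSign d (m + n) = altSign d m * altSign d n := by
  simp only [altSign, Pi.add_apply, Finset.sum_add_distrib]
  exact zpow_add₀ (by norm_num) _ _

lemma altSign_mul_self {d : ℕ} (n : Fin d → ℤ) : altSign d n * altSign d n = 1 := by
  rw [altSign, ← mul_zpow]
  simp

lemma chargeEnergy_altSign {d N : ℕ} (hN : 1 ≤ N) (a : Fin d → ℝ) (q : ℝ) :
    chargeEnergy a N (altSign d) q = epstein a (fun _ => 1 / 2) q := by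
  refine tsum_congr fun n => ?_
  have hNd : (N : ℝ) ^ d ≠ 0 := by positivity
  simp only [altSign_add, ← mul_assoc, altSign_mul_self, ← altSign_eq_cos]
  simp [hNd]

lemma cos_eq_altSign {d : ℕ} {x : Fin d → ℝ} (hx : ∀ i, cos (2 * π * x i) = -1) (n : Fin d → ℤ) :
    cos (2 * π * ∑ i, x i * n i) = altSign d n := by
  have h (i) : ∃ k : ℤ, π + k * (2 * π) = 2 * π * x i := Real.cos_eq_neg_one_iff.1 (hx i)
  choose k hk using h
  have : 2 * π * ∑ i, x i * n i = 2 * π * ∑ i, (1 / 2 : ℝ) * n i + (∑ i, k i * n i : ℤ) * (2 * π) := by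
    push_cast
    rw [Finset.mul_sum, Finset.mul_sum, Finset.sum_mul, ← Finset.sum_add_distrib]
    refine Finset.sum_congr rfl fun i _ => ?_
    rw [← mul_assoc, ← hk i]
    ring
  rw [this, Real.cos_add_int_mul_two_pi, altSign_eq_cos]

lemma even_and_eq_altSign_of_autocorrelation {d N : ℕ} (hd : 1 ≤ d) (hN : 1 ≤ N)
    {φ : (Fin d → ℤ) → ℝ} (hφ : IsChargeDist d N φ)
    (h : ∀ n : Fin d → ℤ, ((N : ℝ) ^ d)⁻¹ * ∑ m : Fin d → Fin N,
        φ (fun i => (m i : ℤ)) * φ ((fun i => (m i : ℤ)) + n) = altSign d n) :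
    Even N ∧ φ = altSign d := by
  obtain ⟨hper, hpos, hnorm⟩ := hφ
  have hNd : (0 : ℝ) < (N : ℝ) ^ d := by positivity
  have h1 (n : Fin d → ℤ) : φ n = altSign d n * φ 0 := by
    have h2 : ∑ m : Fin d → Fin N,
        (φ ((fun i => (m i : ℤ)) + n) - altSign d n * φ (fun i => (m i : ℤ))) ^ 2 = 0 := by
      have h3 := sum_fin_add (φ := fun n => φ n ^ 2) (N := N) (by omega) (fun n i => by rw [hper]) n
      have h4 := h n
      rw [inv_mul_eq_iff_eq_mul₀ hNd.ne'] at h4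
      have e : ∀ m : Fin d → Fin N,
          (φ ((fun i => (m i : ℤ)) + n) - altSign d n * φ (fun i => (m i : ℤ))) ^ 2 =
          φ ((fun i => (m i : ℤ)) + n) ^ 2 - 2 * altSign d n *
            (φ (fun i => (m i : ℤ)) * φ ((fun i => (m i : ℤ)) + n)) + φ (fun i => (m i : ℤ)) ^ 2 := by
        intro m
        linear_combination (φ (fun i => (m i : ℤ)) ^ 2) * altSign_mul_self n
      simp only [e]
      rw [Finset.sum_add_distrib, Finset.sum_sub_distrib, ← Finset.mul_sum, h4, h3, hnorm]
      linear_combination (-2 * (N : ℝ) ^ d) * altSign_mul_self n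
    rw [Finset.sum_eq_zero_iff_of_nonneg (fun _ _ => sq_nonneg _)] at h2
    have h5 := h2 (fun _ => ⟨0, hN⟩) (Finset.mem_univ _)
    have e0 : (fun i : Fin d => (((⟨0, hN⟩ : Fin N) : ℕ) : ℤ)) = 0 := by funext i; simp
    rw [e0, zero_add] at h5
    exact sub_eq_zero.1 (pow_eq_zero_iff two_ne_zero |>.1 h5)
  have h0 : φ 0 = 1 := by
    have e : ∀ m : Fin d → Fin N, φ (fun i => (m i : ℤ)) ^ 2 = φ 0 ^ 2 := by
      intro m
      rw [h1, mul_pow, sq, altSign_mul_self, one_mul]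
    simp only [e, Finset.sum_const, Finset.card_univ, Fintype.card_fun, Fintype.card_fin,
      nsmul_eq_mul, Nat.cast_pow] at hnorm
    have : φ 0 ^ 2 = 1 := by
      field_simp at hnorm
      simpa using hnorm
    nlinarith
  refine ⟨?_, funext fun n => by rw [h1, h0, mul_one]⟩
  have h2 := hper 0 ⟨0, hd⟩
  rw [zero_add, h0, h1, h0, mul_one, altSign] at h2
  simp only [Finset.sum_pi_single', Finset.mem_univ, if_true, zpow_natCast] at h2
  by_contra hodd
  rw [(Nat.not_even_iff_odd.1 hodd).neg_one_pow] at h2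
  norm_num at h2

lemma chargeEnergy_ge {d N : ℕ} (hd : 1 ≤ d) (hN : 1 ≤ N) {a : Fin d → ℝ} (ha : ∀ i, 0 < a i)
    {q : ℝ} (hq : (d : ℝ) / 2 < q) {φ : (Fin d → ℤ) → ℝ} (hφ : IsChargeDist d N φ) :
    epstein a (fun _ => 1 / 2) q ≤ chargeEnergy a N φ q ∧
      (chargeEnergy a N φ q = epstein a (fun _ => 1 / 2) q → Even N ∧ φ = altSign d) := by
  obtain ⟨ι, _, w, x, hw, hw1, hx⟩ := exists_charge_weights hN hφ.1 hφ.2.2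
  have e : chargeEnergy a N φ q - epstein a (fun _ => 1 / 2) q =
      ∑ k, w k * (epstein a (x k) q - epstein a (fun _ => 1 / 2) q) := by
    simp only [mul_sub, Finset.sum_sub_distrib, ← Finset.sum_mul, hw1, one_mul]
    congr 1
    simp only [chargeEnergy, hx, Finset.sum_mul]
    rw [Summable.tsum_finsetSum fun k _ => by
      simpa only [mul_assoc] using (summable_epstein ha hq (x k)).mul_left (w k)]
    refine Finset.sum_congr rfl fun k _ => ?_
    simp only [mul_assoc]
    rw [tsum_mul_left, epstein]
    simp only [mul_assoc]
  have hnn : ∀ k ∈ Finset.univ, 0 ≤ w k * (epstein a (x k) q - epstein a (fun _ => 1 / 2) q) :=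
    fun k _ => mul_nonneg (hw k) (sub_nonneg.2 (epstein_half_le hd ha hq _))
  refine ⟨sub_nonneg.1 (e ▸ Finset.sum_nonneg hnn), fun h => ?_⟩
  rw [h, sub_self, eq_comm, Finset.sum_eq_zero_iff_of_nonneg hnn] at e
  refine even_and_eq_altSign_of_autocorrelation hd hN hφ fun n => ?_
  rw [hx, ← one_mul (altSign d n), ← hw1, Finset.sum_mul]
  refine Finset.sum_congr rfl fun k hk => ?_
  rcases mul_eq_zero.1 (e k hk) with h0 | h0
  · rw [h0, zero_mul, zero_mul]
  · rw [cos_eq_altSign (cos_eq_neg_one_of_epstein_eq hd ha hq (sub_eq_zero.1 h0))]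

lemma Real.abs_exp_sub_one_sub_id_le_sq_mul (x : ℝ) : |exp x - 1 - x| ≤ x ^ 2 * exp |x| := by
  have h := Complex.norm_exp_sub_sum_le_norm_mul_exp (x : ℂ) 2
  simp only [Finset.sum_range_succ, Finset.sum_range_zero] at h
  have e : Complex.exp x - (0 + (x : ℂ) ^ 0 / (Nat.factorial 0 : ℕ) + (x : ℂ) ^ 1 / (Nat.factorial 1 : ℕ)) =
      ((exp x - 1 - x : ℝ) : ℂ) := by
    push_cast
    simp
    ring
  rw [e, Complex.norm_real, Complex.norm_real, Real.norm_eq_abs, Real.norm_eq_abs, sq_abs] at h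
  exact h

lemma abs_rpow_sum_exp_sub_le {ι : Type*} [Fintype ι] {x u : ι → ℝ} {M q : ℝ} (hq : 0 < q)
    (hx : ∀ i, 0 ≤ x i) (hS : 0 < ∑ i, x i) (hu : ∀ i, |u i| ≤ M) (hM : M ≤ 1) :
    |(∑ i, exp (u i) * x i) ^ (-q) - (∑ i, x i) ^ (-q) +
      q * ((∑ i, u i * x i) * (∑ i, x i) ^ (-q - 1))| ≤
      (q ^ 2 * exp q + 2 * q) * M ^ 2 * (∑ i, x i) ^ (-q) := by
  set S := ∑ i, x i with hSdef
  set R := ∑ i, exp (u i) * x i with hR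
  set l := (∑ i, u i * x i) / S with hl
  have hRS1 : R ≤ exp M * S := by
    rw [hR, hSdef, Finset.mul_sum]
    exact Finset.sum_le_sum fun i _ => mul_le_mul_of_nonneg_right
      (exp_le_exp.2 (abs_le.1 (hu i)).2) (hx i)
  have hRS2 : exp (-M) * S ≤ R := by
    rw [hR, hSdef, Finset.mul_sum]
    exact Finset.sum_le_sum fun i _ => mul_le_mul_of_nonneg_right
      (exp_le_exp.2 (abs_le.1 (hu i)).1) (hx i)
  have hR0 : 0 < R := lt_of_lt_of_le (by positivity) hRS2
  have hδ : |R / S - 1 - l| ≤ M ^ 2 := by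
    have e : R / S - 1 - l = (∑ i, (exp (u i) - 1 - u i) * x i) / S := by
      rw [hl]
      simp only [sub_mul, Finset.sum_sub_distrib, one_mul, ← hSdef, ← hR]
      field_simp
    rw [e, abs_div, abs_of_pos hS, div_le_iff₀ hS, hSdef, Finset.mul_sum]
    refine (Finset.abs_sum_le_sum_abs _ _).trans (Finset.sum_le_sum fun i _ => ?_)
    rw [abs_mul, abs_of_nonneg (hx i)]
    refine mul_le_mul_of_nonneg_right ?_ (hx i)
    refine (Real.abs_exp_sub_one_sub_id_le ((hu i).trans hM)).trans ?_
    rw [← sq_abs]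
    exact pow_le_pow_left₀ (abs_nonneg _) (hu i) 2
  set L := log (R / S) with hL
  have hLexp : exp L = R / S := Real.exp_log (by positivity)
  have hLM : |L| ≤ M := by
    rw [abs_le, ← exp_le_exp, ← exp_le_exp (x := L), hLexp, le_div_iff₀ hS, div_le_iff₀ hS]
    exact ⟨hRS2, hRS1⟩
  have hLl : |L - l| ≤ 2 * M ^ 2 := by
    have h1 := (Real.abs_exp_sub_one_sub_id_le (hLM.trans hM))
    rw [hLexp] at h1
    have h2 : L ^ 2 ≤ M ^ 2 := by rw [← sq_abs]; exact pow_le_pow_left₀ (abs_nonneg _) hLM 2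
    rw [abs_le] at *
    constructor <;> linarith [h1.1, h1.2, hδ.1, hδ.2]
  have hRq : R ^ (-q) = S ^ (-q) * exp (-q * L) := by
    have : R = S * exp L := by rw [hLexp]; field_simp
    rw [this, mul_rpow hS.le (exp_pos _).le, ← Real.exp_mul]
    ring_nf
  have hT : |exp (-q * L) - 1 - -q * L| ≤ q ^ 2 * exp q * M ^ 2 := by
    refine (Real.abs_exp_sub_one_sub_id_le_sq_mul _).trans ?_
    have h2 : L ^ 2 ≤ M ^ 2 := by rw [← sq_abs]; exact pow_le_pow_left₀ (abs_nonneg _) hLM 2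
    have h3 : |-q * L| ≤ q := by
      rw [abs_mul, abs_neg, abs_of_pos hq]
      exact mul_le_of_le_one_right hq.le (hLM.trans hM)
    calc (-q * L) ^ 2 * exp |-q * L| ≤ (q ^ 2 * M ^ 2) * exp q := by
          rw [mul_pow, neg_sq]; gcongr
      _ = _ := by ring
  have e : R ^ (-q) - S ^ (-q) + q * ((∑ i, u i * x i) * S ^ (-q - 1)) =
      S ^ (-q) * ((exp (-q * L) - 1 - -q * L) - q * (L - l)) := by
    rw [hRq, Real.rpow_sub_one hS.ne', hl]
    field_simp
    ring
  rw [e, abs_mul, abs_of_pos (rpow_pos_of_pos hS _), mul_comm]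
  refine mul_le_mul_of_nonneg_right ?_ (rpow_pos_of_pos hS _).le
  refine (abs_sub _ _).trans ?_
  rw [abs_mul, abs_of_pos hq]
  nlinarith

section
variable {d : ℕ} {q : ℝ}

lemma sq_mul_Qf_rpow_le (i : Fin d) (n : {n : Fin d → ℤ // n ≠ 0}) :
    (n.1 i : ℝ) ^ 2 * Qf d (fun _ => 1) n.1 ^ (-q - 1) ≤ Qf d (fun _ => 1) n.1 ^ (-q) := by
  have h := Qf_pos (a := fun _ => 1) (fun _ => one_pos) n.2
  rw [Real.rpow_sub_one h.ne', ← mul_div_assoc, div_le_iff₀ h, mul_comm]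
  refine mul_le_mul_of_nonneg_left ?_ (rpow_pos_of_pos h _).le
  simp only [Qf, one_pow, one_mul]
  exact Finset.single_le_sum (f := fun i => (n.1 i : ℝ) ^ 2) (fun i _ => sq_nonneg _) (Finset.mem_univ i)

lemma summable_altSign_sq_mul (hq : (d : ℝ) / 2 < q) (i : Fin d) :
    Summable fun n : {n : Fin d → ℤ // n ≠ 0} =>
      altSign d n.1 * ((n.1 i : ℝ) ^ 2 * Qf d (fun _ => 1) n.1 ^ (-q - 1)) := by
  refine Summable.of_norm_bounded (summable_Qf_rpow (a := fun _ => 1) (fun _ => one_pos) hq) fun n => ?_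
  have h := Qf_pos (a := fun _ => 1) (fun _ => one_pos) n.2
  have h0 : 0 ≤ (n.1 i : ℝ) ^ 2 * Qf d (fun _ => 1) n.1 ^ (-q - 1) := by positivity
  rw [norm_mul, Real.norm_of_nonneg h0, Real.norm_eq_abs, altSign_eq_cos]
  exact (mul_le_of_le_one_left h0 (abs_cos_le_one _)).trans (sq_mul_Qf_rpow_le i n)

lemma tsum_altSign_sq_mul_eq (i j : Fin d) :
    ∑' n : {n : Fin d → ℤ // n ≠ 0},
      altSign d n.1 * ((n.1 i : ℝ) ^ 2 * Qf d (fun _ => 1) n.1 ^ (-q - 1)) =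
    ∑' n : {n : Fin d → ℤ // n ≠ 0},
      altSign d n.1 * ((n.1 j : ℝ) ^ 2 * Qf d (fun _ => 1) n.1 ^ (-q - 1)) := by
  let e : (Fin d → ℤ) ≃ (Fin d → ℤ) := (Equiv.swap i j).arrowCongr (Equiv.refl ℤ)
  have he (n : Fin d → ℤ) (k : Fin d) : e n k = n (Equiv.swap i j k) := by
    simp [e, Equiv.arrowCongr]
  have e0 (n : Fin d → ℤ) : n ≠ 0 ↔ e n ≠ 0 := by
    rw [not_iff_not]
    refine ⟨fun h => by funext k; rw [he, h]; rfl, fun h => ?_⟩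
    funext k
    have := congrFun h (Equiv.swap i j k)
    rwa [he, Equiv.swap_apply_self] at this
  rw [← (e.subtypeEquiv e0).tsum_eq]
  refine tsum_congr fun n => ?_
  have h1 : altSign d (e n.1) = altSign d n.1 := by
    simp only [altSign, he]
    rw [Equiv.sum_comp (Equiv.swap i j) n.1]
  have h2 : Qf d (fun _ => 1) (e n.1) = Qf d (fun _ => 1) n.1 := by
    simp only [Qf, he, one_pow, one_mul]
    exact Equiv.sum_comp (Equiv.swap i j) fun k => (n.1 k : ℝ) ^ 2
  simp only [Equiv.subtypeEquiv_apply, h1, h2, he, Equiv.swap_apply_left]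

lemma exists_abs_epstein_half_sub_le (hq : (d : ℝ) / 2 < q) :
    ∃ C : ℝ, 0 ≤ C ∧ ∀ a u : Fin d → ℝ, ∀ M : ℝ, (∀ i, 0 < a i) → (∀ i, a i ^ 2 = exp (u i)) →
      ∑ i, u i = 0 → (∀ i, |u i| ≤ M) → M ≤ 1 →
      |epstein a (fun _ => 1 / 2) q - epstein (fun _ : Fin d => 1) (fun _ => 1 / 2) q| ≤ C * M ^ 2 := by
  have hq0 : 0 < q := lt_of_le_of_lt (by positivity) hq
  have h1s := summable_Qf_rpow (a := fun _ : Fin d => 1) (fun _ => one_pos) hq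
  refine ⟨(q ^ 2 * exp q + 2 * q) * ∑' n : {n : Fin d → ℤ // n ≠ 0}, Qf d (fun _ => 1) n.1 ^ (-q),
    mul_nonneg (by positivity) (tsum_nonneg fun n => rpow_nonneg (Qf_pos (fun _ => one_pos) n.2).le _), ?_⟩
  intro a u M ha hau hu0 hu hM
  have hlin : HasSum (fun n : {n : Fin d → ℤ // n ≠ 0} =>
      q * (altSign d n.1 * ((∑ i, u i * (n.1 i : ℝ) ^ 2) * Qf d (fun _ => 1) n.1 ^ (-q - 1)))) 0 := by
    have h := hasSum_sum (s := Finset.univ) fun (i : Fin d) _ =>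
      (summable_altSign_sq_mul hq i).hasSum.mul_left (q * u i)
    convert! h using 1
    · funext n
      rw [Finset.sum_mul, Finset.mul_sum, Finset.mul_sum]
      exact Finset.sum_congr rfl fun i _ => by ring
    · rcases isEmpty_or_nonempty (Fin d) with hd | ⟨⟨j⟩⟩
      · simp
      · rw [Finset.sum_congr rfl fun i _ => by rw [tsum_altSign_sq_mul_eq i j], ← Finset.sum_mul,
          ← Finset.mul_sum, hu0]
        simp
  have hs := ((summable_epstein ha hq fun _ => 1 / 2).hasSum.sub
    (summable_epstein (a := fun _ => 1) (fun _ => one_pos) hq fun _ => 1 / 2).hasSum).add hlin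
  rw [add_zero] at hs
  rw [← Real.norm_eq_abs, epstein, epstein, ← hs.tsum_eq, mul_right_comm, ← tsum_mul_left]
  refine tsum_of_norm_bounded (h1s.mul_left _).hasSum fun n => ?_
  rw [← altSign_eq_cos]
  have e : altSign d n.1 * Qf d a n.1 ^ (-q) - altSign d n.1 * Qf d (fun _ => 1) n.1 ^ (-q) +
      q * (altSign d n.1 * ((∑ i, u i * (n.1 i : ℝ) ^ 2) * Qf d (fun _ => 1) n.1 ^ (-q - 1))) =
      altSign d n.1 * (Qf d a n.1 ^ (-q) - Qf d (fun _ => 1) n.1 ^ (-q) +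
        q * ((∑ i, u i * (n.1 i : ℝ) ^ 2) * Qf d (fun _ => 1) n.1 ^ (-q - 1))) := by ring
  rw [e, norm_mul, Real.norm_eq_abs, Real.norm_eq_abs]
  have hQ := Qf_pos (a := fun _ => 1) (fun _ => one_pos) n.2
  have hQ1 : Qf d (fun _ => 1) n.1 = ∑ i, (n.1 i : ℝ) ^ 2 := by simp [Qf]
  have hQa : Qf d a n.1 = ∑ i, exp (u i) * (n.1 i : ℝ) ^ 2 := by simp [Qf, hau]
  have hb := abs_rpow_sum_exp_sub_le hq0 (x := fun i => (n.1 i : ℝ) ^ 2) (u := u)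
    (fun i => sq_nonneg _) (hQ1 ▸ hQ) hu hM
  rw [← hQ1, ← hQa] at hb
  refine (mul_le_of_le_one_left (abs_nonneg _) ?_).trans hb
  rw [altSign_eq_cos]
  exact abs_cos_le_one _

end

lemma cosKernel_zero_exp (v : ℝ) : cosKernel ((0 : ℝ) : UnitAddCircle) (exp v) = exp (logTheta v) := by
  have := cosKernel_pos 0 (exp_pos v)
  rw [logTheta, Real.exp_log (by exact_mod_cast this)]
  norm_cast

lemma logTheta_nonneg (v : ℝ) : 0 ≤ logTheta v := by
  rw [logTheta, ← thetaMoment_zero (exp_pos v)]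
  exact Real.log_nonneg (one_le_thetaMoment_zero (exp_pos v))

section
variable {d : ℕ} {a u : Fin d → ℝ}

lemma thetaProd_zero_exp (hau : ∀ i, a i ^ 2 = exp (u i)) (s : ℝ) :
    thetaProd a (fun _ => 0) (exp s) = exp (∑ i, logTheta (s + u i)) := by
  rw [thetaProd, Real.exp_sum]
  refine Finset.prod_congr rfl fun i _ => ?_
  rw [hau, ← Real.exp_add, cosKernel_zero_exp, add_comm]

lemma sub_le_thetaProd_zero_sub (hau : ∀ i, a i ^ 2 = exp (u i)) (s : ℝ)
    (hA : 0 ≤ ∑ i, (logTheta (s + u i) - logTheta s)) :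
    ∑ i, (logTheta (s + u i) - logTheta s) ≤
      thetaProd a (fun _ => 0) (exp s) - thetaProd (fun _ : Fin d => 1) (fun _ => 0) (exp s) := by
  rw [thetaProd_zero_exp hau, thetaProd_zero_exp (u := fun _ => 0) (by simp)]
  simp only [add_zero]
  have hB : 0 ≤ ∑ _i : Fin d, logTheta s := Finset.sum_nonneg fun i _ => logTheta_nonneg s
  rw [Finset.sum_sub_distrib] at hA ⊢
  set A := ∑ i, logTheta (s + u i)
  set B := ∑ _i : Fin d, logTheta s
  have h1 : exp A = exp B * exp (A - B) := by rw [← Real.exp_add]; ring_nf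
  have h2 := Real.add_one_le_exp (A - B)
  have h3 := Real.one_le_exp hB
  rw [h1]
  nlinarith

lemma sum_logTheta_sub_nonneg (hu : ∑ i, u i = 0) (s : ℝ) :
    0 ≤ ∑ i, (logTheta (s + u i) - logTheta s) := by
  have h : ∑ i, logThetaDeriv s * u i ≤ ∑ i, (logTheta (s + u i) - logTheta s) := by
    refine Finset.sum_le_sum fun i _ => ?_
    have := convexOn_logTheta.add_deriv_mul_le (Set.mem_univ s) (Set.mem_univ (s + u i))
      (hasDerivAt_logTheta s)
    rw [add_sub_cancel_left] at this
    linarith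
  rwa [← Finset.mul_sum, hu, mul_zero] at h

lemma exists_epstein_zero_gap (hd : 1 ≤ d) {p : ℝ} (hp : (d : ℝ) / 2 < p) :
    ∃ c : ℝ, 0 < c ∧ ∀ a u : Fin d → ℝ, (∀ i, 0 < a i) → (∀ i, a i ^ 2 = exp (u i)) →
      ∑ i, u i = 0 → ∀ j, c * min (u j ^ 2) 1 ≤
        epstein a (fun _ => 0) p - epstein (fun _ : Fin d => 1) (fun _ => 0) p := by
  have hp0 : 0 < p := lt_of_le_of_lt (by positivity) hp
  obtain ⟨c, hc, hconv⟩ := exists_logTheta_strong_convexity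
  have hG := Gamma_mul_pi_rpow_pos hp
  have hlen : 0 < exp 2 - exp 1 := sub_pos.2 (exp_lt_exp.2 (by norm_num))
  refine ⟨c * exp (-2) * (exp 2 - exp 1) / (Gamma p * π ^ (-p)), by positivity, ?_⟩
  intro a u ha hau hu j
  have h1 : ∀ i, 0 < (fun _ : Fin d => (1 : ℝ)) i := fun _ => one_pos
  have hnn : ∀ t ∈ Set.Ioi (0 : ℝ), 0 ≤
      (thetaProd a (fun _ => 0) t - thetaProd (fun _ : Fin d => 1) (fun _ => 0) t) * t ^ (p - 1) := by
    intro t ht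
    refine mul_nonneg ?_ (rpow_pos_of_pos ht _).le
    have h2 := sum_logTheta_sub_nonneg hu (log t)
    have h3 := sub_le_thetaProd_zero_sub hau (log t) h2
    rw [Real.exp_log ht] at h3
    exact h2.trans h3
  have hint := integrableOn_thetaProd_sub hd ha hp h1 (fun _ => 0) (fun _ => 0)
  have hsub : Set.Icc (exp 1) (exp 2) ⊆ Set.Ioi 0 := fun t ht => (exp_pos 1).trans_le ht.1
  have hle : ∫ t in Set.Icc (exp 1) (exp 2), c * min (u j ^ 2) 1 * exp (-2) ≤
      ∫ t in Set.Ioi (0 : ℝ), (thetaProd a (fun _ => 0) t -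
        thetaProd (fun _ : Fin d => 1) (fun _ => 0) t) * t ^ (p - 1) := by
    refine le_trans (setIntegral_mono_on (integrableOn_const (by simp)) (hint.mono_set hsub)
      measurableSet_Icc ?_) (setIntegral_mono_set hint
        ((ae_restrict_mem measurableSet_Ioi).mono hnn) hsub.eventuallyLE)
    intro t ht
    have ht0 : 0 < t := hsub ht
    have hs : log t ∈ Set.Icc (1 : ℝ) 2 :=
      ⟨(Real.le_log_iff_exp_le ht0).2 ht.1, (Real.log_le_iff_le_exp ht0).2 ht.2⟩
    have h3 := sub_le_thetaProd_zero_sub hau (log t) (sum_logTheta_sub_nonneg hu _)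
    rw [Real.exp_log ht0] at h3
    have h4 : c * min (u j ^ 2) 1 ≤ ∑ i, (logTheta (log t + u i) - logTheta (log t)) := by
      have h5 : ∑ i, c * min (u i ^ 2) 1 ≤
          ∑ i, (logTheta (log t + u i) - logTheta (log t) - logThetaDeriv (log t) * u i) :=
        Finset.sum_le_sum fun i _ => by linarith [hconv (log t) hs (u i)]
      rw [Finset.sum_sub_distrib, ← Finset.mul_sum _ u, hu, mul_zero, sub_zero] at h5
      refine (Finset.single_le_sum (f := fun i => c * min (u i ^ 2) 1) (fun i _ => ?_)
        (Finset.mem_univ j)).trans h5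
      have : 0 ≤ min (u i ^ 2) 1 := le_min (sq_nonneg _) one_pos.le
      positivity
    have h6 : exp (-2) ≤ t ^ (p - 1) := by
      rw [Real.rpow_def_of_pos ht0, exp_le_exp]
      nlinarith [hs.1, hs.2]
    have h0 : 0 ≤ min (u j ^ 2) 1 := le_min (sq_nonneg _) one_pos.le
    exact mul_le_mul (h4.trans h3) h6 (exp_pos _).le ((by positivity : (0 : ℝ) ≤ _).trans (h4.trans h3))
  rw [epstein_sub_mellin hd ha hp h1, setIntegral_const, smul_eq_mul, Real.volume_real_Icc_of_le
    (exp_le_exp.2 (by norm_num))] at hle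
  rw [div_mul_eq_mul_div, div_le_iff₀ hG]
  linarith

lemma cosKernel_zero_anti {y z : ℝ} (hy : 0 < y) (hyz : y ≤ z) :
    cosKernel (0 : UnitAddCircle) z ≤ cosKernel 0 y := by
  refine hasSum_le (fun n => exp_le_exp.2 ?_) (hasSum_theta (hy.trans_le hyz)) (hasSum_theta hy)
  have : 0 ≤ π * (n : ℝ) ^ 2 := by positivity
  nlinarith

lemma cosKernel_zero_mul_le {t y : ℝ} (ht : 0 < t) (ht1 : t ≤ 1) (hy : 0 < y) :
    cosKernel (0 : UnitAddCircle) (y * t) ≤ t ^ (-(1 / 2 : ℝ)) * cosKernel 0 y := by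
  rw [cosKernel_eq_evenKernel 0 (mul_pos hy ht), cosKernel_eq_evenKernel 0 hy,
    evenKernel_eq_cosKernel_of_zero, ← mul_assoc, one_div (y * t), one_div y, mul_inv,
    Real.mul_rpow (by positivity) (by positivity), Real.inv_rpow ht.le, Real.rpow_neg ht.le,
    mul_comm (y⁻¹ ^ (1 / 2 : ℝ))]
  refine mul_le_mul_of_nonneg_left (cosKernel_zero_anti (by positivity) ?_) (by positivity)
  exact le_mul_of_one_le_right (by positivity) ((one_le_inv₀ ht).2 ht1)

lemma thetaProd_zero_le (ha : ∀ i, 0 < a i) {t : ℝ} (ht : 0 < t) (ht1 : t ≤ 1) :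
    thetaProd a (fun _ => 0) t ≤ t ^ (-((d : ℝ) / 2)) * thetaProd a (fun _ => 0) 1 := by
  have h (i : Fin d) : cosKernel ((0 : ℝ) : UnitAddCircle) (a i ^ 2 * t) ≤
      t ^ (-(1 / 2 : ℝ)) * cosKernel ((0 : ℝ) : UnitAddCircle) (a i ^ 2 * 1) := by
    rw [mul_one]
    exact_mod_cast cosKernel_zero_mul_le ht ht1 (pow_pos (ha i) 2)
  refine (Finset.prod_le_prod (fun i _ => (cosKernel_pos _ (mul_pos (pow_pos (ha i) 2) ht)).le)
    fun i _ => h i).trans_eq ?_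
  rw [Finset.prod_mul_distrib, Finset.prod_const, Finset.card_univ, Fintype.card_fin,
    ← Real.rpow_natCast, ← Real.rpow_mul ht.le, thetaProd]
  congr 2
  ring

lemma thetaProd_zero_one_le (ha : ∀ i, 0 < a i) {p : ℝ} (hp : (d : ℝ) / 2 < p) :
    thetaProd a (fun _ => 0) 1 ≤ 1 + p ^ p * epstein a (fun _ => 0) p := by
  have hp0 : 0 < p := lt_of_le_of_lt (by positivity) hp
  have h := hasSum_thetaProd_sub_one ha (fun _ => 0) one_pos
  have h2 := (summable_epstein ha hp fun _ => 0).hasSum.mul_left (p ^ p)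
  rw [← sub_le_iff_le_add']
  refine hasSum_le (fun n => ?_) h h2
  have hQ := Qf_pos ha n.2
  simp only [zero_mul, Finset.sum_const_zero, mul_zero, cos_zero, one_mul, mul_one]
  set Q := Qf d a n.1
  have h3 : (Q / p) ^ p ≤ exp Q := by
    have : Q / p ≤ exp (Q / p) := by linarith [Real.add_one_le_exp (Q / p)]
    calc (Q / p) ^ p ≤ exp (Q / p) ^ p := Real.rpow_le_rpow (by positivity) this hp0.le
      _ = exp Q := by rw [← Real.exp_mul]; congr 1; field_simp
  rw [Real.div_rpow hQ.le hp0.le, div_le_iff₀ (rpow_pos_of_pos hp0 _)] at h3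
  calc exp (-π * Q) ≤ exp (-Q) := exp_le_exp.2 (by nlinarith [Real.pi_gt_three])
    _ ≤ p ^ p * Q ^ (-p) := by
      rw [Real.exp_neg, Real.rpow_neg hQ.le, ← div_eq_mul_inv, le_div_iff₀ (rpow_pos_of_pos hQ _),
        inv_mul_le_iff₀ (exp_pos _)]
      exact h3

lemma exists_epstein_zero_le (hd : 1 ≤ d) {p q : ℝ} (hq : (d : ℝ) / 2 < q) (hqp : q < p) :
    ∃ C : ℝ, 0 < C ∧ ∀ a : Fin d → ℝ, (∀ i, 0 < a i) →
      epstein a (fun _ => 0) q ≤ C * (1 + epstein a (fun _ => 0) p) := by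
  have hp := hq.trans hqp
  have hp0 : 0 < p := lt_of_le_of_lt (by positivity) hp
  have hGp := Gamma_mul_pi_rpow_pos hp
  have hGq := Gamma_mul_pi_rpow_pos hq
  have hqd : 0 < q - d / 2 := sub_pos.2 hq
  set r := q - (d : ℝ) / 2 with hr
  refine ⟨(Gamma p * π ^ (-p) + (1 + p ^ p) / r) / (Gamma q * π ^ (-q)), by positivity, fun a ha => ?_⟩
  have hE := epstein_zero_pos hd ha hp
  set P1 := thetaProd a (fun _ => 0) 1
  have hP1 : P1 ≤ 1 + p ^ p * epstein a (fun _ => 0) p := thetaProd_zero_one_le ha hp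
  have hP1pos : 0 < P1 := Finset.prod_pos fun i _ => cosKernel_pos _ (by simpa using pow_pos (ha i) 2)
  have hI : IntegrableOn (fun t : ℝ => t ^ (r - 1)) (Set.Ioc 0 1) :=
    (intervalIntegrable_iff_integrableOn_Ioc_of_le zero_le_one).1
      (intervalIntegral.intervalIntegrable_rpow' (by linarith))
  have hI2 : IntegrableOn ((Set.Ioc (0 : ℝ) 1).indicator fun t => P1 * t ^ (r - 1)) (Set.Ioi 0) :=
    ((integrable_indicator_iff measurableSet_Ioc).2 (hI.const_mul P1)).integrableOn
  have hIv : ∫ t in Set.Ioi (0 : ℝ), (Set.Ioc (0 : ℝ) 1).indicator (fun t => P1 * t ^ (r - 1)) t =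
      P1 / r := by
    rw [setIntegral_indicator measurableSet_Ioc, Set.inter_eq_right.2 Set.Ioc_subset_Ioi_self,
      integral_const_mul, ← intervalIntegral.integral_of_le zero_le_one,
      integral_rpow (Or.inl (by linarith))]
    simp [hqd.ne', div_eq_mul_inv]
  have hmono : ∫ t in Set.Ioi (0 : ℝ), (thetaProd a (fun _ => 0) t - 1) * t ^ (q - 1) ≤
      ∫ t in Set.Ioi (0 : ℝ), ((thetaProd a (fun _ => 0) t - 1) * t ^ (p - 1) +
        (Set.Ioc (0 : ℝ) 1).indicator (fun t => P1 * t ^ (r - 1)) t) := by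
    refine setIntegral_mono_on (integrableOn_thetaProd hd ha hq _)
      ((integrableOn_thetaProd hd ha hp _).add hI2) measurableSet_Ioi fun t ht => ?_
    have ht0 : 0 < t := ht
    have hnn : 0 ≤ thetaProd a (fun _ => 0) t - 1 :=
      (abs_nonneg _).trans (abs_thetaProd_sub_one_le ha (fun _ => 0) ht0)
    by_cases ht1 : t ≤ 1
    · rw [Set.indicator_of_mem (show t ∈ Set.Ioc (0 : ℝ) 1 from ⟨ht, ht1⟩)]
      have h1 := thetaProd_zero_le ha ht0 ht1
      have h2 : (thetaProd a (fun _ => 0) t - 1) * t ^ (q - 1) ≤ P1 * t ^ (r - 1) := by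
        calc _ ≤ (t ^ (-((d : ℝ) / 2)) * P1) * t ^ (q - 1) :=
              mul_le_mul_of_nonneg_right (by linarith) (rpow_pos_of_pos ht0 _).le
          _ = P1 * (t ^ (-((d : ℝ) / 2)) * t ^ (q - 1)) := by ring
          _ = _ := by rw [← Real.rpow_add ht0, hr]; ring_nf
      have h3 := mul_nonneg hnn (rpow_pos_of_pos ht0 (p - 1)).le
      linarith
    · rw [Set.indicator_of_notMem fun h => ht1 h.2, add_zero]
      refine mul_le_mul_of_nonneg_left (Real.rpow_le_rpow_of_exponent_le (not_le.1 ht1).le ?_) hnn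
      linarith
  rw [integral_add (integrableOn_thetaProd hd ha hp _) hI2, hIv, epstein_mellin ha hp,
    epstein_mellin ha hq] at hmono
  rw [div_mul_eq_mul_div, le_div_iff₀ hGq, mul_comm]
  refine hmono.trans ?_
  have h5 : P1 / r ≤ (1 + p ^ p) / r * (1 + epstein a (fun _ => 0) p) := by
    rw [div_mul_eq_mul_div, div_le_div_iff_of_pos_right hqd]
    have := rpow_pos_of_pos hp0 p
    nlinarith
  nlinarith

lemma abs_epstein_le (ha : ∀ i, 0 < a i) {q : ℝ} (hq : (d : ℝ) / 2 < q) (x : Fin d → ℝ) :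
    |epstein a x q| ≤ epstein a (fun _ => 0) q := by
  rw [← Real.norm_eq_abs]
  refine tsum_of_norm_bounded (summable_epstein ha hq fun _ => 0).hasSum fun n => ?_
  have := (rpow_pos_of_pos (Qf_pos ha n.2) (-q)).le
  rw [norm_mul, Real.norm_of_nonneg this]
  simpa using mul_le_of_le_one_left this (abs_cos_le_one (2 * π * ∑ i, x i * n.1 i))

end

lemma exists_epstein_combination_min {d : ℕ} (hd : 1 ≤ d) {p q : ℝ} (hq : (d : ℝ) / 2 < q)
    (hqp : q < p) : ∃ ε₀ : ℝ, 0 < ε₀ ∧ ∀ ε : ℝ, 0 < ε → ε < ε₀ →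
      ∀ a : Fin d → ℝ, (∀ i, 0 < a i) → ∏ i, a i = 1 →
        epstein (fun _ : Fin d => 1) (fun _ => 0) p + ε * epstein (fun _ : Fin d => 1) (fun _ => 1 / 2) q ≤
          epstein a (fun _ => 0) p + ε * epstein a (fun _ => 1 / 2) q ∧
        (epstein a (fun _ => 0) p + ε * epstein a (fun _ => 1 / 2) q =
          epstein (fun _ : Fin d => 1) (fun _ => 0) p +
            ε * epstein (fun _ : Fin d => 1) (fun _ => 1 / 2) q → a = fun _ => 1) := by
  have hp := hq.trans hqp
  obtain ⟨c, hc, hgap⟩ := exists_epstein_zero_gap hd hp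
  obtain ⟨C₁, hC₁, htaylor⟩ := exists_abs_epstein_half_sub_le hq
  obtain ⟨C₂, hC₂, hpq⟩ := exists_epstein_zero_le hd hq hqp
  have hpos1 : ∀ i, 0 < (fun _ : Fin d => (1 : ℝ)) i := fun _ => one_pos
  have hZ1 := epstein_zero_pos hd hpos1 hp
  have hF1 := abs_le.1 (abs_epstein_le hpos1 hq fun _ => 1 / 2)
  have hY1 := hpq _ hpos1
  set Z₁ := epstein (fun _ : Fin d => 1) (fun _ => 0) p
  set F₁ := epstein (fun _ : Fin d => 1) (fun _ => 1 / 2) q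
  refine ⟨min (c / (C₁ + 1)) (1 / (C₂ * ((2 + 2 * Z₁) / c + 1))), by positivity, ?_⟩
  intro ε hε hεlt a ha hprod
  obtain ⟨hε1, hε2⟩ := lt_min_iff.1 hεlt
  rw [lt_div_iff₀ (by positivity)] at hε1 hε2
  have hau (i : Fin d) : a i ^ 2 = exp (log (a i ^ 2)) := (Real.exp_log (pow_pos (ha i) 2)).symm
  have hsum : ∑ i, log (a i ^ 2) = 0 := by
    rw [← Real.log_prod fun i _ => (pow_pos (ha i) 2).ne', Finset.prod_pow, hprod]
    simp
  obtain ⟨j, hj⟩ := @Finite.exists_max _ _ _ ⟨(⟨0, hd⟩ : Fin d)⟩ _ fun i => |log (a i ^ 2)|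
  have hg := hgap a _ ha hau hsum j
  set M := |log (a j ^ 2)|
  have hM0 : 0 ≤ M := abs_nonneg _
  rw [← sq_abs] at hg
  have hF := abs_le.1 (abs_epstein_le ha hq fun _ => 1 / 2)
  have hY := hpq a ha
  rcases le_or_gt M 1 with hM | hM
  · have ht := (abs_le.1 (htaylor a _ M ha hau hsum hj hM)).1
    rw [min_eq_left (by nlinarith)] at hg
    have h1 : 0 ≤ M ^ 2 := sq_nonneg M
    have h2 := mul_le_mul_of_nonneg_left ht hε.le
    have h3 : (c - ε * C₁) * M ^ 2 ≤ epstein a (fun _ => 0) p + ε * epstein a (fun _ => 1 / 2) q -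
        (Z₁ + ε * F₁) := by linarith
    have h4 : 0 < c - ε * C₁ := by linarith
    refine ⟨sub_nonneg.1 ((mul_nonneg h4.le h1).trans h3), fun heq => ?_⟩
    rw [heq, sub_self] at h3
    have hM2 : M ^ 2 = 0 := le_antisymm (nonpos_of_mul_nonpos_right h3 h4) h1
    have hMz : M = 0 := pow_eq_zero_iff two_ne_zero |>.1 hM2
    funext i
    have h5 : log (a i ^ 2) = 0 := abs_eq_zero.1 (le_antisymm (hMz ▸ hj i) (abs_nonneg _))
    have h6 := hau i
    rw [h5, Real.exp_zero] at h6
    exact (pow_eq_one_iff_of_nonneg (ha i).le two_ne_zero).1 h6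
  · rw [min_eq_right (by nlinarith), mul_one] at hg
    set D := epstein a (fun _ => 0) p - Z₁ with hD
    have h1 : F₁ - epstein a (fun _ => 1 / 2) q ≤ C₂ * ((2 + 2 * Z₁) / c + 1) * D := by
      have h2 : 2 + 2 * Z₁ ≤ (2 + 2 * Z₁) / c * D := by
        rw [div_mul_eq_mul_div, le_div_iff₀ hc]
        gcongr
      have h3 : C₂ * (2 + 2 * Z₁) ≤ C₂ * ((2 + 2 * Z₁) / c * D) := by gcongr
      have h4 : epstein a (fun _ => 0) p = Z₁ + D := by rw [hD]; ring
      rw [h4] at hY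
      linarith [hF.1, hF1.2]
    have h5 : ε * (F₁ - epstein a (fun _ => 1 / 2) q) < D := by
      have hD0 : 0 < D := hc.trans_le hg
      calc ε * (F₁ - epstein a (fun _ => 1 / 2) q) ≤ ε * (C₂ * ((2 + 2 * Z₁) / c + 1) * D) := by gcongr
        _ = ε * (C₂ * ((2 + 2 * Z₁) / c + 1)) * D := by ring
        _ < 1 * D := by gcongr
        _ = D := one_mul D
    exact ⟨by linarith, fun heq => by linarith⟩

end Auxiliary

/-- At sufficiently high density (small covolume `V`), the rock-salt structure
`(V^{1/d}ℤ^d, φ_±)` is the unique minimizer of `E_{p,q}` among orthorhombic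
lattices of covolume `V` with arbitrary periodic charge distributions. -/
theorem rocksalt_minimal_high_density
    (d : ℕ) (hd : 1 ≤ d) (p q : ℝ) (hq : q > d / 2) (hpq : p > q) :
    ∃ V₀ : ℝ, 0 < V₀ ∧ ∀ V : ℝ, 0 < V → V < V₀ →
      ∀ a : Fin d → ℝ, (∀ i, 0 < a i) → (∏ i, a i) = 1 →
        ∀ N : ℕ, 1 ≤ N → ∀ φ : (Fin d → ℤ) → ℝ, IsChargeDist d N φ →
          Energy d p q V a N φ ≥ Energy d p q V (fun _ => 1) 2 (altSign d) ∧
          (Energy d p q V a N φ = Energy d p q V (fun _ => 1) 2 (altSign d) ↔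
            (Even N ∧ a = (fun _ => 1) ∧ φ = altSign d)) := by
  obtain ⟨ε₀, hε₀, hmin⟩ := exists_epstein_combination_min hd hq hpq
  have hd0 : (0 : ℝ) < d := by exact_mod_cast hd
  have hr : 0 < (2 : ℝ) / d * (p - q) := mul_pos (by positivity) (sub_pos.2 hpq)
  refine ⟨ε₀ ^ ((2 : ℝ) / d * (p - q))⁻¹, Real.rpow_pos_of_pos hε₀ _, ?_⟩
  intro V hV hVlt a ha hprod N hN φ hφ
  have hv := Real.rpow_pos_of_pos hV ((2 : ℝ) / d)
  have hε : (V ^ ((2 : ℝ) / d)) ^ (p - q) < ε₀ := by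
    rw [← Real.rpow_mul hV.le]
    have := Real.rpow_lt_rpow hV.le hVlt hr
    rwa [Real.rpow_inv_rpow hε₀.le hr.ne'] at this
  rw [Energy_eq hV, Energy_eq hV, chargeEnergy_altSign one_le_two]
  set v := V ^ ((2 : ℝ) / d)
  have hvq : v ^ (-q) = v ^ (-p) * v ^ (p - q) := by
    rw [← Real.rpow_add hv]
    ring_nf
  have hvp := Real.rpow_pos_of_pos hv (-p)
  have hε0 := Real.rpow_pos_of_pos hv (p - q)
  obtain ⟨h1, h2⟩ := hmin _ hε0 hε a ha hprod
  obtain ⟨h3, h4⟩ := chargeEnergy_ge hd hN ha hq hφ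
  rw [hvq, mul_assoc, mul_assoc, ← mul_add, ← mul_add]
  set ε := v ^ (p - q)
  have h5 := mul_le_mul_of_nonneg_left h3 hε0.le
  refine ⟨mul_le_mul_of_nonneg_left (by linarith) hvp.le, ?_, ?_⟩
  · intro heq
    have h6 := mul_left_cancel₀ hvp.ne' heq
    have h7 := h2 (by linarith)
    obtain ⟨h8, h9⟩ := h4 (mul_left_cancel₀ hε0.ne' (by linarith))
    exact ⟨h8, h7, h9⟩
  · rintro ⟨-, rfl, rfl⟩
    rw [chargeEnergy_altSign hN]
end
end
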